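/- Assume (A1), (A2), (A3) and the normalization ψ(ξ) = 1 for |ξ| = 1. With p_t^s(x) = (2π)^{-d} ∫_{ℝ^d} e^{-iξ·x} e^{-t ψ^s(ξ)} dξ, where ψ^s(ξ) = s·ψ(ψ^{-1}(1/s)ξ): for every δ > 0 there exist s₀ ≥ 1 and C > 0 such that for all s ≥ s₀, all t > 0 with st ≥ t₀, and all u with |u| ≥ δ, one has p_t^s(u) ≤ C·t·|u|^{-d-α/2}. -/

import Mathlib

open MeasureTheory Filter Real
open scoped RealInnerProductSpace

noncomputable section

/-- Pruitt's concentration function `K(r) = r⁻² ∫_{|z|<r} |z|² ν(|z|) dz`. -/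
def K (d : ℕ) (ν : ℝ → ℝ) (r : ℝ) : ℝ :=
  (∫ z in Metric.ball (0 : EuclideanSpace ℝ (Fin d)) r, ‖z‖ ^ 2 * ν ‖z‖) / r ^ 2

/-- Pruitt's concentration function `h(r) = ∫ (|z|²/r² ∧ 1) ν(|z|) dz`. -/
def hfun (d : ℕ) (ν : ℝ → ℝ) (r : ℝ) : ℝ :=
  ∫ z : EuclideanSpace ℝ (Fin d), min (‖z‖ ^ 2 / r ^ 2) 1 * ν ‖z‖

/-- The characteristic (Lévy–Khintchine) exponent `ψ(ξ) = ∫ (1 - cos⟪ξ,z⟫) ν(|z|) dz`. -/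
def ψ (d : ℕ) (ν : ℝ → ℝ) (ξ : EuclideanSpace ℝ (Fin d)) : ℝ :=
  ∫ z : EuclideanSpace ℝ (Fin d), (1 - Real.cos ⟪ξ, z⟫) * ν ‖z‖

/-- The radial nondecreasing majorant `ψ*(r) = sup_{|z| ≤ r} ψ(z)`. -/
def ψstar (d : ℕ) (ν : ℝ → ℝ) (r : ℝ) : ℝ :=
  sSup {y : ℝ | ∃ z : EuclideanSpace ℝ (Fin d), ‖z‖ ≤ r ∧ ψ d ν z = y}

/-- The generalized inverse `ψ⁻¹(u) = sup {r ≥ 0 : ψ*(r) = u}`. -/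
def ψinv (d : ℕ) (ν : ℝ → ℝ) (u : ℝ) : ℝ :=
  sSup {r : ℝ | 0 ≤ r ∧ ψstar d ν r = u}

/-- Characteristic exponent `ψˢ(ξ) = s·ψ(ψ⁻¹(1/s)ξ)` of the rescaled process. -/
def ψs (d : ℕ) (ν : ℝ → ℝ) (s : ℝ) (ξ : EuclideanSpace ℝ (Fin d)) : ℝ :=
  s * ψ d ν (ψinv d ν (1 / s) • ξ)

/-- Lévy density `νˢ(x) = s·ψ⁻¹(1/s)^{-d}·ν(x/ψ⁻¹(1/s))` of the rescaled process. -/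
def νs (d : ℕ) (ν : ℝ → ℝ) (s : ℝ) (x : EuclideanSpace ℝ (Fin d)) : ℝ :=
  s / ψinv d ν (1 / s) ^ d * ν (‖x‖ / ψinv d ν (1 / s))

/-- `ψ^{-1,s}(u) = ψ⁻¹(u/s)/ψ⁻¹(1/s)`. -/
def ψinvs (d : ℕ) (ν : ℝ → ℝ) (s u : ℝ) : ℝ :=
  ψinv d ν (u / s) / ψinv d ν (1 / s)

/-- The stable constant `𝒜(d,α)`. -/
def Aconst (d : ℕ) (α : ℝ) : ℝ :=
  α * (2 : ℝ) ^ (α - 1) * Real.Gamma (((d : ℝ) + α) / 2) /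
    (Real.Gamma (1 - α / 2) * Real.pi ^ ((d : ℝ) / 2))

/-- Heat kernel of the rescaled process, via Fourier inversion. -/
def pts (d : ℕ) (ν : ℝ → ℝ) (s t : ℝ) (x : EuclideanSpace ℝ (Fin d)) : ℝ :=
  ((2 * Real.pi) ^ d)⁻¹ *
    ∫ ξ : EuclideanSpace ℝ (Fin d), Real.cos ⟪ξ, x⟫ * Real.exp (-(t * ψs d ν s ξ))

/-- Heat kernel of the isotropic α-stable process. -/
def ptα (d : ℕ) (α t : ℝ) (x : EuclideanSpace ℝ (Fin d)) : ℝ :=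
  ((2 * Real.pi) ^ d)⁻¹ *
    ∫ ξ : EuclideanSpace ℝ (Fin d), Real.cos ⟪ξ, x⟫ * Real.exp (-(t * ‖ξ‖ ^ α))

/-- Heat kernel of the original process, via Fourier inversion. -/
def pt (d : ℕ) (ν : ℝ → ℝ) (t : ℝ) (x : EuclideanSpace ℝ (Fin d)) : ℝ :=
  ((2 * Real.pi) ^ d)⁻¹ *
    ∫ ξ : EuclideanSpace ℝ (Fin d), Real.cos ⟪ξ, x⟫ * Real.exp (-(t * ψ d ν ξ))

namespace LevyHeatKernel

section Unimodal

variable {E : Type*} [NormedAddCommGroup E]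

/-- Nonnegative and nonincreasing in the norm. -/
def IsUnimodal (f : E → ℝ) : Prop :=
  (∀ x, 0 ≤ f x) ∧ ∀ x y, ‖x‖ ≤ ‖y‖ → f y ≤ f x

theorem IsUnimodal.of_tendsto {F : ℕ → E → ℝ} {f : E → ℝ} (hF : ∀ n, IsUnimodal (F n))
    (h : ∀ x, Tendsto (fun n => F n x) atTop (nhds (f x))) : IsUnimodal f :=
  ⟨fun x => ge_of_tendsto' (h x) fun n => (hF n).1 x,
    fun x y hxy => le_of_tendsto_of_tendsto' (h y) (h x) fun n => (hF n).2 x y hxy⟩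

theorem IsUnimodal.const_mul {f : E → ℝ} (hf : IsUnimodal f) {c : ℝ} (hc : 0 ≤ c) :
    IsUnimodal (fun x => c * f x) :=
  ⟨fun x => mul_nonneg hc (hf.1 x),
    fun x y hxy => mul_le_mul_of_nonneg_left (hf.2 x y hxy) hc⟩

theorem IsUnimodal.sum {ι : Type*} {s : Finset ι} {F : ι → E → ℝ}
    (hF : ∀ i ∈ s, IsUnimodal (F i)) : IsUnimodal (fun x => ∑ i ∈ s, F i x) :=
  ⟨fun x => Finset.sum_nonneg fun i hi => (hF i hi).1 x,
    fun x y hxy => Finset.sum_le_sum fun i hi => (hF i hi).2 x y hxy⟩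

variable [InnerProductSpace ℝ E] [FiniteDimensional ℝ E] [MeasurableSpace E] [BorelSpace E]

/-- The cosine transform `x ↦ ∫ cos⟪ξ,x⟫ φ(ξ) dξ`. -/
def cosTransform (φ : E → ℝ) (x : E) : ℝ := ∫ ξ : E, Real.cos ⟪ξ, x⟫ * φ ξ

theorem measurePreserving_swap_points (x y : E) :
    MeasurePreserving
      (fun z : E => z - (2 * ⟪z - (1 / 2 : ℝ) • (x + y), x - y⟫ / ‖x - y‖ ^ 2) • (x - y))
      volume volume := by
  set m : E := (1 / 2 : ℝ) • (x + y)
  set e : E := x - y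
  have h1 := (Submodule.reflection (ℝ ∙ e)ᗮ).measurePreserving
  have h2 := measurePreserving_sub_right (volume : Measure E) m
  have h3 := measurePreserving_add_right (volume : Measure E) m
  convert h3.comp (h1.comp h2) using 1
  funext z
  simp only [Function.comp, Submodule.reflection_orthogonal_apply,
    Submodule.reflection_singleton_apply]
  rw [real_inner_comm]
  simp only [RCLike.ofReal_real_eq_id, id]
  module

/-- Wintner's theorem, by reflection in the bisector of two points. -/
theorem IsUnimodal.conv {f g : E → ℝ} (hf : IsUnimodal f) (hg : IsUnimodal g)
    (hfi : Integrable f) (hgc : Continuous g) :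
    IsUnimodal (fun x => ∫ z, f z * g (x - z)) := by
  have hgb : ∀ x, ‖g x‖ ≤ g 0 := fun x => by
    rw [Real.norm_of_nonneg (hg.1 x)]
    exact hg.2 0 x (by simp)
  have hint : ∀ x, Integrable (fun z => f z * g (x - z)) := fun x =>
    hfi.mul_bdd (c := g 0) (by fun_prop) (Eventually.of_forall fun z => hgb _)
  refine ⟨fun x => integral_nonneg fun z => mul_nonneg (hf.1 z) (hg.1 _), fun x y hxy => ?_⟩
  rcases eq_or_ne x y with rfl | hne
  · exact le_rfl
  have hmp := measurePreserving_swap_points x y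
  set m : E := (1 / 2 : ℝ) • (x + y) with hm
  set e : E := x - y with he
  have he0 : 0 < ‖e‖ ^ 2 := by
    have : 0 < ‖e‖ := norm_pos_iff.mpr (sub_ne_zero.mpr hne)
    positivity
  set R : E → E := fun z => z - (2 * ⟪z - m, e⟫ / ‖e‖ ^ 2) • e with hR
  have hee : ⟪e, e⟫ = ‖e‖ ^ 2 := real_inner_self_eq_norm_sq e
  have hme : 2 * ⟪m, e⟫ = ‖x‖ ^ 2 - ‖y‖ ^ 2 := by
    rw [hm, he, inner_smul_left, inner_add_left, inner_sub_right, inner_sub_right,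
      real_inner_self_eq_norm_sq, real_inner_self_eq_norm_sq, real_inner_comm x y]
    simp
  have hRz : ∀ z, ‖R z‖ ^ 2 = ‖z‖ ^ 2 - (2 * ⟪z - m, e⟫ / ‖e‖ ^ 2) * (2 * ⟪m, e⟫) := by
    intro z
    have : ⟪z - m, e⟫ = ⟪z, e⟫ - ⟪m, e⟫ := inner_sub_left _ _ _
    simp only [hR]
    rw [norm_sub_sq_real, inner_smul_right, norm_smul, mul_pow, Real.norm_eq_abs, sq_abs, this]
    field_simp
    ring
  have hxm : x - m = (1 / 2 : ℝ) • e := by rw [hm, he]; module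
  have hym : y - m = -((1 / 2 : ℝ) • e) := by rw [hm, he]; module
  have hdist : ∀ z, ‖x - z‖ ^ 2 = ‖z - m‖ ^ 2 - ⟪z - m, e⟫ + ‖e‖ ^ 2 / 4 ∧
      ‖y - z‖ ^ 2 = ‖z - m‖ ^ 2 + ⟪z - m, e⟫ + ‖e‖ ^ 2 / 4 := by
    intro z
    constructor
    · rw [show x - z = (x - m) - (z - m) by abel, hxm, norm_sub_sq_real, norm_smul,
        inner_smul_left, real_inner_comm]
      simp; ring
    · rw [show y - z = (y - m) - (z - m) by abel, hym, norm_sub_sq_real, norm_neg, norm_smul,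
        inner_neg_left, inner_smul_left, real_inner_comm]
      simp; ring
  have hRm : ∀ z, ‖R z - m‖ ^ 2 = ‖z - m‖ ^ 2 ∧ ⟪R z - m, e⟫ = -⟪z - m, e⟫ := by
    intro z
    have : R z - m = (z - m) - (2 * ⟪z - m, e⟫ / ‖e‖ ^ 2) • e := by simp only [hR]; abel
    rw [this]
    constructor
    · rw [norm_sub_sq_real, inner_smul_right, norm_smul, mul_pow, Real.norm_eq_abs, sq_abs]
      field_simp
      ring
    · rw [inner_sub_left, inner_smul_left, hee, RCLike.conj_to_real, div_mul_cancel₀ _ he0.ne']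
      ring
  have hxR : ∀ z, ‖x - R z‖ = ‖y - z‖ := fun z => by
    rw [← sq_eq_sq₀ (norm_nonneg _) (norm_nonneg _), (hdist _).1, (hdist _).2, (hRm z).1,
      (hRm z).2]; ring
  have hyR : ∀ z, ‖y - R z‖ = ‖x - z‖ := fun z => by
    rw [← sq_eq_sq₀ (norm_nonneg _) (norm_nonneg _), (hdist _).1, (hdist _).2, (hRm z).1,
      (hRm z).2]; ring
  have geq : ∀ a b : E, ‖a‖ = ‖b‖ → g a = g b := fun a b h =>
    le_antisymm (hg.2 b a h.ge) (hg.2 a b h.le)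
  set k : E → ℝ := fun z => g (x - z) - g (y - z) with hk
  have hkR : ∀ z, k (R z) = -k z := fun z => by
    simp only [hk]
    rw [geq _ _ (hxR z), geq _ _ (hyR z)]; ring
  have hkc : Continuous k := by fun_prop
  have hkb : ∀ z, ‖k z‖ ≤ g 0 + g 0 := fun z =>
    (norm_sub_le _ _).trans (add_le_add (hgb _) (hgb _))
  have hfk : Integrable (fun z => f z * k z) :=
    hfi.mul_bdd (c := g 0 + g 0) hkc.aestronglyMeasurable (Eventually.of_forall hkb)
  have hfRi : Integrable (fun z => f (R z)) := hmp.integrable_comp_of_integrable hfi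
  have hfRk : Integrable (fun z => f (R z) * k z) :=
    hfRi.mul_bdd (c := g 0 + g 0) hkc.aestronglyMeasurable (Eventually.of_forall hkb)
  have hswap : ∫ z, f z * k z = -∫ z, f (R z) * k z := by
    have h1 : ∫ z, f z * k z = ∫ z, f (R z) * k (R z) := by
      have := hmp.map_eq
      conv_lhs => rw [← this]
      exact integral_map hmp.measurable.aemeasurable (by rw [this]; exact hfk.1)
    rw [h1, ← integral_neg]
    congr 1; funext z; rw [hkR]; ring
  have hpos : 0 ≤ ∫ z, (f z - f (R z)) * k z := by
    refine integral_nonneg fun z => ?_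
    have hxy2 : ‖x‖ ^ 2 ≤ ‖y‖ ^ 2 := by gcongr
    rcases le_total 0 ⟪z - m, e⟫ with h | h
    · refine mul_nonneg (sub_nonneg.2 (hf.2 _ _ ?_)) (sub_nonneg.2 (hg.2 _ _ ?_))
      · refine (sq_le_sq₀ (norm_nonneg _) (norm_nonneg _)).1 ?_
        rw [hRz, hme]
        have : 0 ≤ 2 * ⟪z - m, e⟫ / ‖e‖ ^ 2 := by positivity
        nlinarith
      · refine (sq_le_sq₀ (norm_nonneg _) (norm_nonneg _)).1 ?_
        rw [(hdist z).1, (hdist z).2]; linarith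
    · refine mul_nonneg_of_nonpos_of_nonpos (sub_nonpos.2 (hf.2 _ _ ?_))
        (sub_nonpos.2 (hg.2 _ _ ?_))
      · refine (sq_le_sq₀ (norm_nonneg _) (norm_nonneg _)).1 ?_
        rw [hRz, hme]
        have : 2 * ⟪z - m, e⟫ / ‖e‖ ^ 2 ≤ 0 :=
          div_nonpos_of_nonpos_of_nonneg (by linarith) he0.le
        nlinarith
      · refine (sq_le_sq₀ (norm_nonneg _) (norm_nonneg _)).1 ?_
        rw [(hdist z).1, (hdist z).2]; linarith
  have hexp : ∫ z, (f z - f (R z)) * k z = 2 * ∫ z, f z * k z := by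
    simp only [sub_mul]
    rw [integral_sub hfk hfRk]; linarith
  have hfin : ∫ z, f z * k z = (∫ z, f z * g (x - z)) - ∫ z, f z * g (y - z) := by
    rw [← integral_sub (hint x) (hint y)]
    congr 1; funext z; simp only [hk]; ring
  show ∫ z, f z * g (y - z) ≤ ∫ z, f z * g (x - z)
  linarith

theorem integrable_cos_mul {φ : E → ℝ} (hφ : Integrable φ) (x : E) :
    Integrable (fun ξ : E => Real.cos ⟪ξ, x⟫ * φ ξ) :=
  hφ.bdd_mul (c := 1) (Continuous.aestronglyMeasurable (by fun_prop))
    (Eventually.of_forall fun ξ => Real.abs_cos_le_one _)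

theorem continuous_cosTransform {φ : E → ℝ} (hφ : Integrable φ) :
    Continuous (cosTransform φ) := by
  refine continuous_of_dominated (bound := fun ξ => ‖φ ξ‖)
    (fun x => (integrable_cos_mul hφ x).1) (fun x => Eventually.of_forall fun ξ => ?_) hφ.norm
    (Eventually.of_forall fun ξ => by fun_prop)
  rw [norm_mul]
  exact mul_le_of_le_one_left (norm_nonneg _) (Real.abs_cos_le_one _)

theorem abs_cosTransform_le {φ : E → ℝ} (x : E) (hφ : Integrable φ) :
    |cosTransform φ x| ≤ ∫ ξ, |φ ξ| := by
  refine norm_integral_le_of_norm_le (f := fun ξ : E => Real.cos ⟪ξ, x⟫ * φ ξ) hφ.norm (Eventually.of_forall fun ξ => ?_)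
  rw [norm_mul]
  exact mul_le_of_le_one_left (norm_nonneg _) (Real.abs_cos_le_one _)

theorem tendsto_cosTransform {F : ℕ → E → ℝ} {φ bound : E → ℝ}
    (hF : ∀ n, AEStronglyMeasurable (F n)) (hb : Integrable bound)
    (hle : ∀ n ξ, |F n ξ| ≤ bound ξ) (hlim : ∀ ξ, Tendsto (fun n => F n ξ) atTop (nhds (φ ξ)))
    (x : E) : Tendsto (fun n => cosTransform (F n) x) atTop (nhds (cosTransform φ x)) := by
  refine tendsto_integral_of_dominated_convergence bound (fun n => ?_) hb
    (fun n => Eventually.of_forall fun ξ => ?_)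
    (Eventually.of_forall fun ξ => (hlim ξ).const_mul _)
  · exact (Continuous.aestronglyMeasurable (by fun_prop)).mul (hF n)
  · rw [norm_mul]
    exact (mul_le_of_le_one_left (norm_nonneg _) (Real.abs_cos_le_one _)).trans (hle n ξ)

/-- The cosine transform of a product is a convolution, for an even factor. -/
theorem cosTransform_mul {f φ : E → ℝ} (hf : Integrable f) (hfe : ∀ z, f (-z) = f z)
    (hφ : Integrable φ) (x : E) :
    cosTransform (fun ξ => cosTransform f ξ * φ ξ) x
      = ∫ z, f z * cosTransform φ (x - z) := by
  have hsin : ∀ ξ : E, ∫ z, Real.sin ⟪ξ, z⟫ * f z = 0 := fun ξ => by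
    have := integral_neg_eq_self (fun z => Real.sin ⟪ξ, z⟫ * f z) (volume : Measure E)
    simp only [inner_neg_right, Real.sin_neg, hfe, neg_mul, integral_neg] at this
    linarith
  have hsini : ∀ ξ : E, Integrable (fun z => Real.sin ⟪ξ, z⟫ * f z) := fun ξ =>
    hf.bdd_mul (c := 1) (Continuous.aestronglyMeasurable (by fun_prop))
      (Eventually.of_forall fun z => Real.abs_sin_le_one _)
  have hcosi : ∀ ξ : E, Integrable (fun z => Real.cos ⟪ξ, z⟫ * f z) := fun ξ =>
    hf.bdd_mul (c := 1) (Continuous.aestronglyMeasurable (by fun_prop))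
      (Eventually.of_forall fun z => Real.abs_cos_le_one _)
  have hinner : ∀ ξ : E, Real.cos ⟪ξ, x⟫ * (cosTransform f ξ * φ ξ)
      = ∫ z, φ ξ * f z * Real.cos ⟪ξ, x - z⟫ := fun ξ => by
    have : ∀ z, φ ξ * f z * Real.cos ⟪ξ, x - z⟫
        = (φ ξ * Real.cos ⟪ξ, x⟫) * (Real.cos ⟪ξ, z⟫ * f z)
          + (φ ξ * Real.sin ⟪ξ, x⟫) * (Real.sin ⟪ξ, z⟫ * f z) := fun z => by
      rw [inner_sub_right, Real.cos_sub]; ring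
    simp only [this]
    rw [integral_add ((hcosi ξ).const_mul _) ((hsini ξ).const_mul _), integral_const_mul,
      integral_const_mul, hsin, cosTransform]
    simp only [real_inner_comm ξ]
    ring
  unfold cosTransform at hinner ⊢
  simp only [hinner]
  rw [integral_integral_swap]
  · congr 1; funext z
    rw [← integral_const_mul]
    congr 1; funext ξ; ring
  · exact (hφ.mul_prod hf).mul_bdd (c := 1) (Continuous.aestronglyMeasurable (by fun_prop))
      (Eventually.of_forall fun p => Real.abs_cos_le_one _)

theorem IsUnimodal.cosTransform_mul {f φ : E → ℝ} (hf : Integrable f) (hfu : IsUnimodal f)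
    (hφ : Integrable φ) (hφu : IsUnimodal (cosTransform φ)) :
    IsUnimodal (cosTransform (fun ξ => cosTransform f ξ * φ ξ)) := by
  have hfe : ∀ z, f (-z) = f z := fun z =>
    le_antisymm (hfu.2 _ _ (norm_neg z).ge) (hfu.2 _ _ (norm_neg z).le)
  have := hfu.conv hφu hf (continuous_cosTransform hφ)
  convert this using 1
  funext x
  exact LevyHeatKernel.cosTransform_mul hf hfe hφ x

theorem integrable_exp_neg_mul_sq_norm {c : ℝ} (hc : 0 < c) :
    Integrable (fun ξ : E => Real.exp (-(c * ‖ξ‖ ^ 2))) := by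
  have := (GaussianFourier.integrable_cexp_neg_mul_sq_norm_add (V := E) (b := (c : ℂ))
    (by simpa using hc) 0 0).re
  refine this.congr (Eventually.of_forall fun v => ?_)
  have : Complex.exp (-(c : ℂ) * (‖v‖ : ℂ) ^ 2 + 0 * ((⟪(0 : E), v⟫ : ℝ) : ℂ))
      = ((Real.exp (-(c * ‖v‖ ^ 2)) : ℝ) : ℂ) := by
    push_cast; congr 1; ring
  have hre := congrArg Complex.re this
  rw [Complex.ofReal_re] at hre
  exact hre

theorem cosTransform_gaussian {c : ℝ} (hc : 0 < c) (x : E) :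
    cosTransform (fun ξ : E => Real.exp (-(c * ‖ξ‖ ^ 2))) x
      = (π / c) ^ ((Module.finrank ℝ E : ℝ) / 2) * Real.exp (-(‖x‖ ^ 2 / (4 * c))) := by
  have h := GaussianFourier.integral_cexp_neg_mul_sq_norm_add (V := E) (b := (c : ℂ))
    (by simpa using hc) Complex.I x
  have hi := GaussianFourier.integrable_cexp_neg_mul_sq_norm_add (V := E) (b := (c : ℂ))
    (by simpa using hc) Complex.I x
  have h2 := congrArg Complex.re h
  have h3 : (∫ v : E, Complex.exp (-(c : ℂ) * (‖v‖ : ℂ) ^ 2 + Complex.I * ((⟪x, v⟫ : ℝ) : ℂ))).re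
      = ∫ v : E, (Complex.exp (-(c : ℂ) * (‖v‖ : ℂ) ^ 2
          + Complex.I * ((⟪x, v⟫ : ℝ) : ℂ))).re := (integral_re hi).symm
  rw [h3] at h2
  have h4 : ∀ v : E, (Complex.exp (-(c : ℂ) * (‖v‖ : ℂ) ^ 2
      + Complex.I * ((⟪x, v⟫ : ℝ) : ℂ))).re = Real.cos ⟪v, x⟫ * Real.exp (-(c * ‖v‖ ^ 2)) := by
    intro v
    have : -(c : ℂ) * (‖v‖ : ℂ) ^ 2 + Complex.I * ((⟪x, v⟫ : ℝ) : ℂ)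
        = ((-(c * ‖v‖ ^ 2) : ℝ) : ℂ) + ((⟪v, x⟫ : ℝ) : ℂ) * Complex.I := by
      rw [real_inner_comm]; push_cast; ring
    rw [this, Complex.exp_re]
    simp only [Complex.add_re, Complex.ofReal_re, Complex.add_im, Complex.ofReal_im,
      Complex.re_ofReal_mul, Complex.im_ofReal_mul, Complex.I_re, Complex.I_im]
    simp [mul_comm]
  simp only [h4] at h2
  rw [cosTransform, h2]
  have h5 : ((π : ℂ) / (c : ℂ)) ^ ((Module.finrank ℝ E : ℂ) / 2)
      * Complex.exp (Complex.I ^ 2 * (‖x‖ : ℂ) ^ 2 / (4 * (c : ℂ)))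
      = (((π / c) ^ ((Module.finrank ℝ E : ℝ) / 2) * Real.exp (-(‖x‖ ^ 2 / (4 * c))) : ℝ) : ℂ) := by
    push_cast
    rw [Complex.ofReal_cpow (by positivity)]
    push_cast
    congr 2
    rw [Complex.I_sq]; ring
  rw [h5, Complex.ofReal_re]

theorem isUnimodal_cosTransform_gaussian {c : ℝ} (hc : 0 < c) :
    IsUnimodal (cosTransform (fun ξ : E => Real.exp (-(c * ‖ξ‖ ^ 2)))) := by
  refine ⟨fun x => ?_, fun x y hxy => ?_⟩
  · rw [cosTransform_gaussian hc]; positivity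
  · rw [cosTransform_gaussian hc, cosTransform_gaussian hc]
    gcongr

/-- A regularised compound Poisson semigroup with unimodal jump density is unimodal. -/
theorem isUnimodal_cosTransform_exp {f : E → ℝ} (hf : Integrable f) (hfu : IsUnimodal f)
    {c : ℝ} (hc : 0 < c) {T : ℝ} (hT : 0 ≤ T) :
    IsUnimodal (cosTransform (fun ξ : E =>
      Real.exp (T * cosTransform f ξ) * Real.exp (-(c * ‖ξ‖ ^ 2)))) := by
  set m := cosTransform f with hm
  have hmc : Continuous m := continuous_cosTransform hf
  set B : ℝ := ∫ z, |f z| with hB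
  have hmb : ∀ ξ, |m ξ| ≤ B := fun ξ => abs_cosTransform_le ξ hf
  have hB0 : 0 ≤ B := integral_nonneg fun z => abs_nonneg _
  have hgi := integrable_exp_neg_mul_sq_norm (E := E) hc
  have hpow : ∀ k : ℕ, Integrable (fun ξ : E => m ξ ^ k * Real.exp (-(c * ‖ξ‖ ^ 2))) := fun k =>
    hgi.bdd_mul (c := B ^ k) (by fun_prop)
      (Eventually.of_forall fun ξ => by
        rw [norm_pow]; exact pow_le_pow_left₀ (norm_nonneg _) (hmb ξ) k)
  have hpu : ∀ k : ℕ,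
      IsUnimodal (cosTransform fun ξ : E => m ξ ^ k * Real.exp (-(c * ‖ξ‖ ^ 2))) := by
    intro k
    induction k with
    | zero => simpa using isUnimodal_cosTransform_gaussian (E := E) hc
    | succ k ih =>
      have := IsUnimodal.cosTransform_mul hf hfu (hpow k) ih
      convert this using 3 with ξ
      rw [pow_succ]; ring
  set F : ℕ → E → ℝ := fun N ξ =>
    (∑ k ∈ Finset.range N, (T * m ξ) ^ k / (k.factorial : ℝ)) * Real.exp (-(c * ‖ξ‖ ^ 2)) with hF
  refine IsUnimodal.of_tendsto (F := fun N => cosTransform (F N)) (fun N => ?_)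
    (tendsto_cosTransform (bound := fun ξ => Real.exp (T * B) * Real.exp (-(c * ‖ξ‖ ^ 2)))
      (fun n => ?_) (hgi.const_mul _) (fun n ξ => ?_) fun ξ => ?_)
  · have : cosTransform (F N) = fun x => ∑ k ∈ Finset.range N, T ^ k / (k.factorial : ℝ) *
        cosTransform (fun ξ : E => m ξ ^ k * Real.exp (-(c * ‖ξ‖ ^ 2))) x := by
      funext x
      simp only [cosTransform, ← integral_const_mul]
      rw [← integral_finsetSum]
      · congr 1; funext ξ
        simp only [hF]
        rw [Finset.sum_mul, Finset.mul_sum]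
        refine Finset.sum_congr rfl fun k _ => ?_
        rw [mul_pow]; ring
      · exact fun k _ => (integrable_cos_mul (hpow k) x).const_mul _
    rw [this]
    exact IsUnimodal.sum fun k _ => (hpu k).const_mul (by positivity)
  · exact Continuous.aestronglyMeasurable (by fun_prop)
  · rw [hF, abs_mul, abs_of_pos (Real.exp_pos (-(c * ‖ξ‖ ^ 2)))]
    gcongr
    refine (Finset.abs_sum_le_sum_abs _ _).trans ?_
    refine le_trans (Finset.sum_le_sum fun k _ => ?_)
      (Real.sum_le_exp_of_nonneg (mul_nonneg hT hB0) n)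
    rw [abs_div, abs_pow, abs_mul, abs_of_nonneg hT, Nat.abs_cast]
    gcongr
    exact hmb ξ
  · refine Tendsto.mul_const _ ?_
    rw [Real.exp_eq_exp_ℝ]
    exact (NormedSpace.expSeries_div_hasSum_exp (T * m ξ)).tendsto_sum_nat

end Unimodal
section Exponent

theorem one_sub_exp_neg_le_min {a v : ℝ} (ha : 0 ≤ a) (hv : 0 ≤ v) :
    1 - Real.exp (-(a * v)) ≤ (1 + a) * min v 1 := by
  have h1 := Real.add_one_le_exp (-(a * v))
  have h2 := Real.exp_pos (-(a * v))
  rcases min_cases v 1 with ⟨h, _⟩ | ⟨h, _⟩ <;> rw [h] <;> nlinarith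

theorem one_sub_exp_neg_nonneg {v : ℝ} (hv : 0 ≤ v) : 0 ≤ 1 - Real.exp (-v) := by
  have : Real.exp (-v) ≤ 1 := Real.exp_le_one_iff.2 (by linarith)
  linarith

theorem one_add_mul_exp_neg_le {c v : ℝ} (hv : 0 ≤ v) (hc : 0 ≤ c) :
    (1 + 4 * c * v) * Real.exp (-(c * v)) ≤ 9 * Real.exp (-(c / 2 * v)) := by
  have hcv : 0 ≤ c * v := mul_nonneg hc hv
  have h1 : Real.exp (-(c * v)) = Real.exp (-(c / 2 * v)) * Real.exp (-(c / 2 * v)) := by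
    rw [← Real.exp_add]; ring_nf
  have h2 : (1 + 4 * c * v) * Real.exp (-(c / 2 * v)) ≤ 9 := by
    rw [Real.exp_neg, ← div_eq_mul_inv, div_le_iff₀ (Real.exp_pos _)]
    have := Real.add_one_le_exp (c / 2 * v)
    nlinarith
  rw [h1, ← mul_assoc]
  exact mul_le_mul_of_nonneg_right h2 (Real.exp_pos _).le

theorem one_sub_cos_two_mul_le (θ : ℝ) : 1 - Real.cos (2 * θ) ≤ 4 * (1 - Real.cos θ) := by
  rw [Real.cos_two_mul]
  nlinarith [sq_nonneg (1 - Real.cos θ)]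

variable {d : ℕ} {ν : ℝ → ℝ}

theorem one_sub_cos_inner_le (ξ z : EuclideanSpace ℝ (Fin d)) :
    1 - Real.cos ⟪ξ, z⟫ ≤ 2 * (1 + ‖ξ‖ ^ 2) * min (‖z‖ ^ 2) 1 := by
  have h1 := Real.one_sub_sq_div_two_le_cos (x := ⟪ξ, z⟫)
  have h2 : ⟪ξ, z⟫ ^ 2 ≤ ‖ξ‖ ^ 2 * ‖z‖ ^ 2 := by
    rw [← mul_pow]
    exact sq_le_sq.2 ((abs_real_inner_le_norm ξ z).trans (le_abs_self _))
  have h3 := Real.neg_one_le_cos ⟪ξ, z⟫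
  have h4 := sq_nonneg ‖ξ‖
  have h5 := sq_nonneg ‖z‖
  rcases min_cases (‖z‖ ^ 2) 1 with ⟨h, _⟩ | ⟨h, _⟩ <;> rw [h] <;> nlinarith

theorem ae_ne_zero (hd : 1 ≤ d) : ∀ᵐ z : EuclideanSpace ℝ (Fin d), z ≠ 0 := by
  have : Nonempty (Fin d) := ⟨⟨0, hd⟩⟩
  have : Nontrivial (EuclideanSpace ℝ (Fin d)) := inferInstance
  exact Measure.ae_ne volume 0

theorem aestronglyMeasurable_density (hd : 1 ≤ d)
    (hint : Integrable (fun z : EuclideanSpace ℝ (Fin d) => min (‖z‖ ^ 2) 1 * ν ‖z‖)) :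
    AEStronglyMeasurable (fun z : EuclideanSpace ℝ (Fin d) => ν ‖z‖) := by
  have h : AEStronglyMeasurable (fun z : EuclideanSpace ℝ (Fin d) =>
      (min (‖z‖ ^ 2) 1)⁻¹ * (min (‖z‖ ^ 2) 1 * ν ‖z‖)) := by
    refine AEStronglyMeasurable.mul ?_ hint.1
    exact (Measurable.inv (by fun_prop)).aestronglyMeasurable
  refine h.congr ?_
  filter_upwards [ae_ne_zero hd] with z hz
  have : 0 < min (‖z‖ ^ 2) 1 := lt_min (by have := norm_pos_iff.2 hz; positivity) one_pos
  exact inv_mul_cancel_left₀ this.ne' _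

theorem abs_mul_density_le {p q y : ℝ} (hp : 0 ≤ p) {m : ℝ} (hm : 0 ≤ m) (h : p ≤ q * m) :
    |p * y| ≤ q * |m * y| := by
  rw [abs_mul, abs_mul, abs_of_nonneg hp, abs_of_nonneg hm, ← mul_assoc]
  exact mul_le_mul_of_nonneg_right h (abs_nonneg _)

theorem min_sq_one_nonneg (z : EuclideanSpace ℝ (Fin d)) : 0 ≤ min (‖z‖ ^ 2) 1 :=
  le_min (sq_nonneg _) zero_le_one

theorem integrable_one_sub_cos (hd : 1 ≤ d)
    (hint : Integrable (fun z : EuclideanSpace ℝ (Fin d) => min (‖z‖ ^ 2) 1 * ν ‖z‖))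
    (ξ : EuclideanSpace ℝ (Fin d)) :
    Integrable (fun z : EuclideanSpace ℝ (Fin d) => (1 - Real.cos ⟪ξ, z⟫) * ν ‖z‖) := by
  refine (hint.abs.const_mul (2 * (1 + ‖ξ‖ ^ 2))).mono'
    ((Continuous.aestronglyMeasurable (by fun_prop)).mul (aestronglyMeasurable_density hd hint))
    (Eventually.of_forall fun z => ?_)
  exact abs_mul_density_le (by linarith [Real.cos_le_one ⟪ξ, z⟫]) (min_sq_one_nonneg z)
    (one_sub_cos_inner_le ξ z)

theorem psi_nonneg (hd : 1 ≤ d) (hν_pos : ∀ r : ℝ, 0 < r → 0 < ν r)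
    (ξ : EuclideanSpace ℝ (Fin d)) : 0 ≤ ψ d ν ξ := by
  refine integral_nonneg_of_ae ?_
  filter_upwards [ae_ne_zero hd] with z hz
  exact mul_nonneg (by linarith [Real.cos_le_one ⟪ξ, z⟫]) (hν_pos _ (norm_pos_iff.2 hz)).le

theorem aestronglyMeasurable_psi (hd : 1 ≤ d)
    (hint : Integrable (fun z : EuclideanSpace ℝ (Fin d) => min (‖z‖ ^ 2) 1 * ν ‖z‖)) :
    AEStronglyMeasurable (ψ d ν) := by
  have h : AEStronglyMeasurable (fun p : EuclideanSpace ℝ (Fin d) × EuclideanSpace ℝ (Fin d) =>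
      (1 - Real.cos ⟪p.1, p.2⟫) * ν ‖p.2‖) (volume.prod volume) :=
    (Continuous.aestronglyMeasurable (by fun_prop)).mul
      (aestronglyMeasurable_density hd hint).comp_snd
  exact h.integral_prod_right'

theorem psi_le (hd : 1 ≤ d)
    (hint : Integrable (fun z : EuclideanSpace ℝ (Fin d) => min (‖z‖ ^ 2) 1 * ν ‖z‖))
    (ξ : EuclideanSpace ℝ (Fin d)) :
    ψ d ν ξ ≤ 2 * (1 + ‖ξ‖ ^ 2) * ∫ z : EuclideanSpace ℝ (Fin d), |min (‖z‖ ^ 2) 1 * ν ‖z‖| := by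
  rw [← integral_const_mul]
  refine integral_mono (integrable_one_sub_cos hd hint ξ) (hint.abs.const_mul _) fun z => ?_
  exact (le_abs_self _).trans (abs_mul_density_le (by linarith [Real.cos_le_one ⟪ξ, z⟫])
    (min_sq_one_nonneg z) (one_sub_cos_inner_le ξ z))

theorem psi_two_smul_le (hd : 1 ≤ d) (hν_pos : ∀ r : ℝ, 0 < r → 0 < ν r)
    (hint : Integrable (fun z : EuclideanSpace ℝ (Fin d) => min (‖z‖ ^ 2) 1 * ν ‖z‖))
    (ξ : EuclideanSpace ℝ (Fin d)) : ψ d ν ((2 : ℝ) • ξ) ≤ 4 * ψ d ν ξ := by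
  unfold ψ
  rw [← integral_const_mul]
  refine integral_mono_ae (integrable_one_sub_cos hd hint _)
    ((integrable_one_sub_cos hd hint _).const_mul _) ?_
  filter_upwards [ae_ne_zero hd] with z hz
  rw [inner_smul_left, RCLike.conj_to_real, ← mul_assoc]
  exact mul_le_mul_of_nonneg_right (one_sub_cos_two_mul_le _) (hν_pos _ (norm_pos_iff.2 hz)).le

/-- The Gaussian average of `ψ`: `∫ (1 - exp(-a|z|²)) ν(|z|) dz`. -/
def gaussExponent (d : ℕ) (ν : ℝ → ℝ) (a : ℝ) : ℝ :=
  ∫ z : EuclideanSpace ℝ (Fin d), (1 - Real.exp (-(a * ‖z‖ ^ 2))) * ν ‖z‖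

theorem integrable_gaussExponent (hd : 1 ≤ d)
    (hint : Integrable (fun z : EuclideanSpace ℝ (Fin d) => min (‖z‖ ^ 2) 1 * ν ‖z‖))
    {a : ℝ} (ha : 0 ≤ a) :
    Integrable (fun z : EuclideanSpace ℝ (Fin d) =>
      (1 - Real.exp (-(a * ‖z‖ ^ 2))) * ν ‖z‖) := by
  refine (hint.abs.const_mul (1 + a)).mono'
    ((Continuous.aestronglyMeasurable (by fun_prop)).mul (aestronglyMeasurable_density hd hint))
    (Eventually.of_forall fun z => ?_)
  exact abs_mul_density_le (one_sub_exp_neg_nonneg (by positivity)) (min_sq_one_nonneg z)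
    (one_sub_exp_neg_le_min ha (sq_nonneg _))

theorem gaussExponent_mono (hd : 1 ≤ d) (hν_pos : ∀ r : ℝ, 0 < r → 0 < ν r)
    (hint : Integrable (fun z : EuclideanSpace ℝ (Fin d) => min (‖z‖ ^ 2) 1 * ν ‖z‖))
    {a b : ℝ} (ha : 0 ≤ a) (hab : a ≤ b) : gaussExponent d ν a ≤ gaussExponent d ν b := by
  refine integral_mono_ae (integrable_gaussExponent hd hint ha)
    (integrable_gaussExponent hd hint (ha.trans hab)) ?_
  filter_upwards [ae_ne_zero hd] with z hz
  have := (hν_pos _ (norm_pos_iff.2 hz)).le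
  gcongr

theorem gaussExponent_mul_le (hd : 1 ≤ d) (hν_pos : ∀ r : ℝ, 0 < r → 0 < ν r)
    (hint : Integrable (fun z : EuclideanSpace ℝ (Fin d) => min (‖z‖ ^ 2) 1 * ν ‖z‖))
    {a c : ℝ} (ha : 0 ≤ a) (hc : 1 ≤ c) :
    gaussExponent d ν (c * a) ≤ c * gaussExponent d ν a := by
  unfold gaussExponent
  rw [← integral_const_mul]
  refine integral_mono_ae (integrable_gaussExponent hd hint (by positivity))
    ((integrable_gaussExponent hd hint ha).const_mul _) ?_
  filter_upwards [ae_ne_zero hd] with z hz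
  have h0 := (hν_pos _ (norm_pos_iff.2 hz)).le
  rw [← mul_assoc]
  refine mul_le_mul_of_nonneg_right ?_ h0
  have h := one_add_mul_self_le_rpow_one_add (s := Real.exp (-(a * ‖z‖ ^ 2)) - 1)
    (by linarith [Real.exp_pos (-(a * ‖z‖ ^ 2))]) hc
  rw [add_sub_cancel, ← Real.exp_mul] at h
  rw [show -(c * a * ‖z‖ ^ 2) = -(a * ‖z‖ ^ 2) * c by ring]
  linarith

theorem gaussExponent_pos (hd : 1 ≤ d) (hν_pos : ∀ r : ℝ, 0 < r → 0 < ν r)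
    (hint : Integrable (fun z : EuclideanSpace ℝ (Fin d) => min (‖z‖ ^ 2) 1 * ν ‖z‖))
    {a : ℝ} (ha : 0 < a) : 0 < gaussExponent d ν a := by
  have hpos : ∀ᵐ z : EuclideanSpace ℝ (Fin d),
      0 < (1 - Real.exp (-(a * ‖z‖ ^ 2))) * ν ‖z‖ := by
    filter_upwards [ae_ne_zero hd] with z hz
    have hz := norm_pos_iff.2 hz
    refine mul_pos ?_ (hν_pos _ hz)
    have : Real.exp (-(a * ‖z‖ ^ 2)) < 1 := Real.exp_lt_one_iff.2 (neg_neg_of_pos (by positivity))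
    linarith
  refine (integral_pos_iff_support_of_nonneg_ae (hpos.mono fun z hz => hz.le)
    (integrable_gaussExponent hd hint ha.le)).2 ?_
  have : (volume : Measure (EuclideanSpace ℝ (Fin d))) Set.univ ≤
      volume (Function.support fun z : EuclideanSpace ℝ (Fin d) =>
        (1 - Real.exp (-(a * ‖z‖ ^ 2))) * ν ‖z‖) :=
    measure_mono_ae (hpos.mono fun z hz _ => hz.ne')
  refine lt_of_lt_of_le ?_ this
  exact isOpen_univ.measure_pos volume Set.univ_nonempty

theorem integrable_one_add_sq_mul_gaussian {c : ℝ} (hc : 0 < c) :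
    Integrable (fun ξ : EuclideanSpace ℝ (Fin d) =>
      (1 + 4 * c * ‖ξ‖ ^ 2) * Real.exp (-(c * ‖ξ‖ ^ 2))) := by
  refine ((integrable_exp_neg_mul_sq_norm (E := EuclideanSpace ℝ (Fin d))
    (half_pos hc)).const_mul 9).mono' (Continuous.aestronglyMeasurable (by fun_prop))
    (Eventually.of_forall fun ξ => ?_)
  rw [Real.norm_of_nonneg (by positivity)]
  exact one_add_mul_exp_neg_le (sq_nonneg _) hc.le

theorem integral_psi_mul_gaussian (hd : 1 ≤ d)
    (hint : Integrable (fun z : EuclideanSpace ℝ (Fin d) => min (‖z‖ ^ 2) 1 * ν ‖z‖))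
    {c : ℝ} (hc : 0 < c) :
    Integrable (fun ξ => ψ d ν ξ * Real.exp (-(c * ‖ξ‖ ^ 2))) ∧
    ∫ ξ, ψ d ν ξ * Real.exp (-(c * ‖ξ‖ ^ 2))
      = (π / c) ^ ((d : ℝ) / 2) * gaussExponent d ν (1 / (4 * c)) := by
  set g : EuclideanSpace ℝ (Fin d) → ℝ := fun ξ => Real.exp (-(c * ‖ξ‖ ^ 2)) with hg
  have hgi : Integrable g := integrable_exp_neg_mul_sq_norm hc
  have hF : Integrable (Function.uncurry fun ξ z : EuclideanSpace ℝ (Fin d) =>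
      (1 - Real.cos ⟪ξ, z⟫) * ν ‖z‖ * g ξ) (volume.prod volume) := by
    refine (((integrable_one_add_sq_mul_gaussian (d := d) hc).const_mul
      (2 * (1 + 1 / (4 * c)))).mul_prod hint.abs).mono'
      (((Continuous.aestronglyMeasurable (by fun_prop)).mul
        (aestronglyMeasurable_density hd hint).comp_snd).mul
        (Continuous.aestronglyMeasurable (by fun_prop))) (Eventually.of_forall fun p => ?_)
    obtain ⟨ξ, z⟩ := p
    simp only [Function.uncurry, norm_mul (_ * _) (g ξ)]
    have hgp : 0 < g ξ := Real.exp_pos _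
    rw [Real.norm_of_nonneg hgp.le, Real.norm_eq_abs]
    have h1 := abs_mul_density_le (y := ν ‖z‖) (by linarith [Real.cos_le_one ⟪ξ, z⟫])
      (min_sq_one_nonneg z) (one_sub_cos_inner_le ξ z)
    have h2 : 1 + ‖ξ‖ ^ 2 ≤ (1 + 1 / (4 * c)) * (1 + 4 * c * ‖ξ‖ ^ 2) := by
      have : (1 + 1 / (4 * c)) * (1 + 4 * c * ‖ξ‖ ^ 2)
          = 1 + ‖ξ‖ ^ 2 + 4 * c * ‖ξ‖ ^ 2 + 1 / (4 * c) := by field_simp; ring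
      rw [this]
      have : 0 ≤ 4 * c * ‖ξ‖ ^ 2 + 1 / (4 * c) := by positivity
      linarith
    calc |(1 - Real.cos ⟪ξ, z⟫) * ν ‖z‖| * g ξ
        ≤ 2 * (1 + ‖ξ‖ ^ 2) * |min (‖z‖ ^ 2) 1 * ν ‖z‖| * g ξ := by gcongr
      _ ≤ 2 * ((1 + 1 / (4 * c)) * (1 + 4 * c * ‖ξ‖ ^ 2)) * |min (‖z‖ ^ 2) 1 * ν ‖z‖| * g ξ := by
          gcongr
      _ = _ := by ring
  have hpsi : ∀ ξ, ψ d ν ξ * g ξ = ∫ z : EuclideanSpace ℝ (Fin d),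
      (1 - Real.cos ⟪ξ, z⟫) * ν ‖z‖ * g ξ := fun ξ => (integral_mul_const _ _).symm
  constructor
  · exact hF.integral_prod_left.congr (Eventually.of_forall fun ξ => (hpsi ξ).symm)
  · refine (integral_congr_ae (Eventually.of_forall hpsi)).trans ?_
    rw [integral_integral_swap hF, gaussExponent, ← integral_const_mul]
    congr 1; funext z
    have h1 : ∀ ξ : EuclideanSpace ℝ (Fin d), (1 - Real.cos ⟪ξ, z⟫) * ν ‖z‖ * g ξ
        = ν ‖z‖ * (Real.cos ⟪ξ, 0⟫ * g ξ - Real.cos ⟪ξ, z⟫ * g ξ) := fun ξ => by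
      rw [inner_zero_right, Real.cos_zero]; ring
    simp only [h1]
    rw [integral_const_mul, integral_sub (integrable_cos_mul hgi 0) (integrable_cos_mul hgi z)]
    have h2 := cosTransform_gaussian hc z
    have h3 := cosTransform_gaussian hc (0 : EuclideanSpace ℝ (Fin d))
    unfold cosTransform at h2 h3
    rw [h2, h3, finrank_euclideanSpace_fin, norm_zero]
    simp only [ne_eq, OfNat.ofNat_ne_zero, not_false_eq_true, zero_pow, zero_div, neg_zero,
      Real.exp_zero, mul_one]
    rw [show 1 / (4 * c) * ‖z‖ ^ 2 = ‖z‖ ^ 2 / (4 * c) by ring]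
    ring

/-- A bound for `ψ` on a ball propagates quadratically. -/
theorem psi_le_of_le_on_ball (hd : 1 ≤ d) (hν_pos : ∀ r : ℝ, 0 < r → 0 < ν r)
    (hint : Integrable (fun z : EuclideanSpace ℝ (Fin d) => min (‖z‖ ^ 2) 1 * ν ‖z‖))
    {b σ : ℝ} (hb : 0 < b) (hσ : 0 ≤ σ)
    (h : ∀ ξ : EuclideanSpace ℝ (Fin d), ‖ξ‖ < b → ψ d ν ξ ≤ σ)
    (ξ : EuclideanSpace ℝ (Fin d)) : ψ d ν ξ ≤ 4 * σ * (1 + ‖ξ‖ ^ 2 / b ^ 2) := by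
  have hk : ∀ (k : ℕ) (ξ : EuclideanSpace ℝ (Fin d)), ‖ξ‖ < 2 ^ k * b → ψ d ν ξ ≤ 4 ^ k * σ := by
    intro k
    induction k with
    | zero => intro ξ hξ; simpa using h ξ (by simpa using hξ)
    | succ k ih =>
      intro ξ hξ
      have h1 := psi_two_smul_le hd hν_pos hint ((1 / 2 : ℝ) • ξ)
      rw [smul_smul, show (2 : ℝ) * (1 / 2) = 1 by norm_num, one_smul] at h1
      have h2 := ih ((1 / 2 : ℝ) • ξ) (by
        rw [norm_smul, Real.norm_of_nonneg (by norm_num)]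
        rw [pow_succ] at hξ; linarith)
      rw [pow_succ]; linarith
  have hq : 0 ≤ ‖ξ‖ ^ 2 / b ^ 2 := by positivity
  rcases lt_or_ge ‖ξ‖ b with hξ | hξ
  · have := h ξ hξ
    nlinarith [mul_nonneg hσ hq]
  · obtain ⟨n, hn1, hn2⟩ := exists_nat_pow_near (x := ‖ξ‖ / b) (y := 2)
      ((one_le_div hb).2 hξ) one_lt_two
    have h1 := hk (n + 1) ξ ((div_lt_iff₀ hb).1 hn2)
    have h2 : (4 : ℝ) ^ n ≤ ‖ξ‖ ^ 2 / b ^ 2 := by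
      rw [← div_pow, show (4 : ℝ) = 2 ^ 2 by norm_num, ← pow_mul, mul_comm, pow_mul]
      gcongr
    rw [pow_succ] at h1
    nlinarith [mul_le_mul_of_nonneg_right h2 hσ]

theorem gaussExponent_le_of_psi_le_on_ball (hd : 1 ≤ d) (hν_pos : ∀ r : ℝ, 0 < r → 0 < ν r)
    (hint : Integrable (fun z : EuclideanSpace ℝ (Fin d) => min (‖z‖ ^ 2) 1 * ν ‖z‖))
    {b σ : ℝ} (hb : 0 < b) (hσ : 0 ≤ σ)
    (h : ∀ ξ : EuclideanSpace ℝ (Fin d), ‖ξ‖ < b → ψ d ν ξ ≤ σ) :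
    gaussExponent d ν (b ^ 2) ≤ 36 * 2 ^ ((d : ℝ) / 2) * σ := by
  set c : ℝ := 1 / (4 * b ^ 2) with hc
  have hc0 : 0 < c := by positivity
  obtain ⟨hi, heq⟩ := integral_psi_mul_gaussian (ν := ν) hd hint hc0
  have hcb : 1 / (4 * c) = b ^ 2 := by rw [hc]; field_simp
  have h4c : ∀ v : ℝ, v / b ^ 2 = 4 * c * v := fun v => by rw [hc]; field_simp
  have hgi := (integrable_exp_neg_mul_sq_norm (E := EuclideanSpace ℝ (Fin d)) (half_pos hc0))
  have h1 : ∫ ξ, ψ d ν ξ * Real.exp (-(c * ‖ξ‖ ^ 2))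
      ≤ ∫ ξ : EuclideanSpace ℝ (Fin d), 36 * σ * Real.exp (-(c / 2 * ‖ξ‖ ^ 2)) := by
    refine integral_mono hi (hgi.const_mul _) fun ξ => ?_
    have h2 := psi_le_of_le_on_ball hd hν_pos hint hb hσ h ξ
    rw [h4c] at h2
    have h3 := one_add_mul_exp_neg_le (sq_nonneg ‖ξ‖) hc0.le
    have h4 := mul_le_mul_of_nonneg_right h2 (Real.exp_pos (-(c * ‖ξ‖ ^ 2))).le
    dsimp only
    nlinarith
  have hg := cosTransform_gaussian (half_pos hc0) (0 : EuclideanSpace ℝ (Fin d))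
  simp only [cosTransform, inner_zero_right, Real.cos_zero, one_mul, norm_zero, ne_eq,
    OfNat.ofNat_ne_zero, not_false_eq_true, zero_pow, zero_div, neg_zero, Real.exp_zero, mul_one,
    finrank_euclideanSpace_fin] at hg
  rw [integral_const_mul, hg, heq, hcb,
    show π / (c / 2) = 2 * (π / c) by field_simp, Real.mul_rpow (by norm_num) (by positivity)] at h1
  have hp : 0 < (π / c) ^ ((d : ℝ) / 2) := by positivity
  refine le_of_mul_le_mul_left ?_ hp
  linarith

end Exponent

section HeatKernel

theorem integral_cosTransform_mul {E : Type*} [NormedAddCommGroup E] [InnerProductSpace ℝ E]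
    [FiniteDimensional ℝ E] [MeasurableSpace E] [BorelSpace E] {φ w : E → ℝ}
    (hφ : Integrable φ) (hw : Integrable w) :
    ∫ y, cosTransform φ y * w y = ∫ ξ, φ ξ * cosTransform w ξ := by
  simp only [cosTransform, ← integral_const_mul, ← integral_mul_const]
  rw [integral_integral_swap]
  · congr 1; funext ξ
    congr 1; funext y
    rw [real_inner_comm]; ring
  · have := (hw.mul_prod hφ).mul_bdd (c := 1) (g := fun p : E × E => Real.cos ⟪p.2, p.1⟫)
      (Continuous.aestronglyMeasurable (by fun_prop))
      (Eventually.of_forall fun p => Real.abs_cos_le_one _)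
    refine this.congr (Eventually.of_forall fun p => ?_)
    simp only [Function.uncurry]; ring

theorem integral_exp_neg_mul_sq_norm {c : ℝ} (d : ℕ) (hc : 0 < c) :
    ∫ ξ : EuclideanSpace ℝ (Fin d), Real.exp (-(c * ‖ξ‖ ^ 2)) = (π / c) ^ ((d : ℝ) / 2) := by
  have hg := cosTransform_gaussian hc (0 : EuclideanSpace ℝ (Fin d))
  simpa [cosTransform] using hg

variable {d : ℕ} {ν : ℝ → ℝ}

/-- The heat kernel at times where `exp(-Tψ)` is integrable is unimodal. -/
theorem isUnimodal_cosTransform_exp_neg_psi (hd : 1 ≤ d)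
    (hν_pos : ∀ r : ℝ, 0 < r → 0 < ν r)
    (hν_mono : ∀ r₁ r₂ : ℝ, 0 < r₁ → r₁ ≤ r₂ → ν r₂ ≤ ν r₁)
    (hint : Integrable (fun z : EuclideanSpace ℝ (Fin d) => min (‖z‖ ^ 2) 1 * ν ‖z‖))
    {T : ℝ} (hT : 0 ≤ T)
    (hTi : Integrable (fun ξ : EuclideanSpace ℝ (Fin d) => Real.exp (-(T * ψ d ν ξ)))) :
    IsUnimodal (cosTransform (fun ξ => Real.exp (-(T * ψ d ν ξ)))) := by
  have hψ0 := psi_nonneg hd hν_pos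
  have hψm := aestronglyMeasurable_psi hd hint
  set ε : ℕ → ℝ := fun n => 1 / ((n : ℝ) + 1) with hε
  have hε0 : ∀ n, 0 < ε n := fun n => Nat.one_div_pos_of_nat
  have hεlim : Tendsto ε atTop (nhds 0) := tendsto_one_div_add_atTop_nhds_zero_nat
  set f : ℕ → EuclideanSpace ℝ (Fin d) → ℝ := fun n z => ν (max ‖z‖ (ε n)) with hf
  have hmax : ∀ n (z : EuclideanSpace ℝ (Fin d)), 0 < max ‖z‖ (ε n) := fun n z =>
    lt_max_of_lt_right (hε0 n)
  have hfu : ∀ n, IsUnimodal (f n) := fun n =>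
    ⟨fun z => (hν_pos _ (hmax n z)).le,
      fun x y hxy => hν_mono _ _ (hmax n x) (max_le_max hxy le_rfl)⟩
  have hfm : ∀ n, Measurable (f n) := fun n => by
    have hanti : Antitone fun r : ℝ => ν (max r (ε n)) := fun r r' h =>
      hν_mono _ _ (lt_max_of_lt_right (hε0 n)) (max_le_max h le_rfl)
    exact hanti.measurable.comp measurable_norm
  have hfle : ∀ n (z : EuclideanSpace ℝ (Fin d)), z ≠ 0 → f n z ≤ ν ‖z‖ := fun n z hz =>
    hν_mono _ _ (norm_pos_iff.2 hz) (le_max_left _ _)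
  have hfi : ∀ n, Integrable (f n) := fun n => by
    have hball : Integrable ((Metric.ball (0 : EuclideanSpace ℝ (Fin d)) 1).indicator
        fun _ => ν (ε n)) :=
      (integrable_indicator_iff Metric.isOpen_ball.measurableSet).2
        (integrableOn_const (measure_ball_lt_top.ne))
    refine (hint.abs.add hball).mono' (hfm n).aestronglyMeasurable ?_
    filter_upwards [ae_ne_zero hd] with z hz
    rw [Real.norm_of_nonneg ((hfu n).1 z)]
    have hz' := norm_pos_iff.2 hz
    simp only [Pi.add_apply]
    by_cases h1 : ‖z‖ < 1
    · rw [Set.indicator_of_mem (by simpa using h1)]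
      have : f n z ≤ ν (ε n) := hν_mono _ _ (hε0 n) (le_max_right _ _)
      linarith [abs_nonneg (min (‖z‖ ^ 2) 1 * ν ‖z‖)]
    · rw [Set.indicator_of_notMem (by simpa using h1), add_zero,
        min_eq_right (one_le_pow₀ (not_lt.1 h1)), one_mul]
      exact (hfle n z hz).trans (le_abs_self _)
  set ψn : ℕ → EuclideanSpace ℝ (Fin d) → ℝ := fun n ξ =>
    cosTransform (f n) 0 - cosTransform (f n) ξ with hψn
  have hψn_eq : ∀ n ξ, ψn n ξ = ∫ z, (1 - Real.cos ⟪ξ, z⟫) * f n z := fun n ξ => by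
    simp only [hψn, cosTransform]
    rw [← integral_sub (integrable_cos_mul (hfi n) 0) (integrable_cos_mul (hfi n) ξ)]
    congr 1; funext z
    rw [inner_zero_right, Real.cos_zero, real_inner_comm]; ring
  have hψn0 : ∀ n ξ, 0 ≤ ψn n ξ := fun n ξ => by
    rw [hψn_eq]
    exact integral_nonneg fun z =>
      mul_nonneg (by linarith [Real.cos_le_one ⟪ξ, z⟫]) ((hfu n).1 z)
  have hψnc : ∀ n, Continuous (ψn n) := fun n =>
    continuous_const.sub (continuous_cosTransform (hfi n))
  have hψnlim : ∀ ξ, Tendsto (fun n => ψn n ξ) atTop (nhds (ψ d ν ξ)) := fun ξ => by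
    simp only [hψn_eq]
    refine tendsto_integral_of_dominated_convergence
      (fun z => (1 - Real.cos ⟪ξ, z⟫) * ν ‖z‖) (fun n => ?_)
      (integrable_one_sub_cos hd hint ξ) (fun n => ?_) ?_
    · exact (Continuous.aestronglyMeasurable (by fun_prop)).mul (hfm n).aestronglyMeasurable
    · filter_upwards [ae_ne_zero hd] with z hz
      have h1 : 0 ≤ 1 - Real.cos ⟪ξ, z⟫ := by linarith [Real.cos_le_one ⟪ξ, z⟫]
      rw [Real.norm_of_nonneg (mul_nonneg h1 ((hfu n).1 z))]
      exact mul_le_mul_of_nonneg_left (hfle n z hz) h1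
    · filter_upwards [ae_ne_zero hd] with z hz
      refine Tendsto.const_mul _ (tendsto_const_nhds.congr' ?_)
      filter_upwards [hεlim.eventually_lt_const (norm_pos_iff.2 hz)] with n hn
      simp only [hf]
      rw [max_eq_left hn.le]
  have hexp_le : ∀ v : ℝ, 0 ≤ v → Real.exp (-(T * v)) ≤ 1 := fun v hv =>
    Real.exp_le_one_iff.2 (neg_nonpos.2 (mul_nonneg hT hv))
  have hreg : ∀ k, IsUnimodal (cosTransform fun ξ : EuclideanSpace ℝ (Fin d) =>
      Real.exp (-(T * ψ d ν ξ)) * Real.exp (-(ε k * ‖ξ‖ ^ 2))) := fun k => by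
    refine IsUnimodal.of_tendsto (F := fun n => cosTransform fun ξ =>
      Real.exp (-(T * ψn n ξ)) * Real.exp (-(ε k * ‖ξ‖ ^ 2))) (fun n => ?_)
      (tendsto_cosTransform (bound := fun ξ => Real.exp (-(ε k * ‖ξ‖ ^ 2)))
        (fun n => ?_) (integrable_exp_neg_mul_sq_norm (hε0 k)) (fun n ξ => ?_) fun ξ => ?_)
    · have h := (isUnimodal_cosTransform_exp (hfi n) (hfu n) (hε0 k) hT).const_mul
        (Real.exp_pos (-(T * cosTransform (f n) 0))).le
      convert h using 1
      funext x
      change (∫ ξ, Real.cos ⟪ξ, x⟫ *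
          (Real.exp (-(T * ψn n ξ)) * Real.exp (-(ε k * ‖ξ‖ ^ 2)))) =
        Real.exp (-(T * cosTransform (f n) 0)) * ∫ ξ, Real.cos ⟪ξ, x⟫ *
          (Real.exp (T * cosTransform (f n) ξ) * Real.exp (-(ε k * ‖ξ‖ ^ 2)))
      rw [← integral_const_mul]
      congr 1; funext ξ
      have hexp : -(T * ψn n ξ) =
          -(T * cosTransform (f n) 0) + T * cosTransform (f n) ξ := by
        simp only [hψn]; ring
      rw [hexp, Real.exp_add]; ring
    · have := hψnc n
      exact Continuous.aestronglyMeasurable (by fun_prop)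
    · rw [abs_of_pos (by positivity)]
      exact mul_le_of_le_one_left (Real.exp_pos _).le (hexp_le _ (hψn0 n ξ))
    · exact (((Real.continuous_exp.tendsto _).comp
        ((hψnlim ξ).const_mul T).neg)).mul_const _
  refine IsUnimodal.of_tendsto hreg
    (tendsto_cosTransform (bound := fun ξ => Real.exp (-(T * ψ d ν ξ)))
      (fun k => ?_) hTi (fun k ξ => ?_) fun ξ => ?_)
  · exact hTi.1.mul (Continuous.aestronglyMeasurable (by fun_prop))
  · rw [abs_of_pos (by positivity)]
    refine mul_le_of_le_one_right (Real.exp_pos _).le (Real.exp_le_one_iff.2 ?_)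
    have := (hε0 k).le
    rw [neg_nonpos]; positivity
  · have h1 : Tendsto (fun k => Real.exp (-(ε k * ‖ξ‖ ^ 2))) atTop (nhds 1) := by
      have := (Real.continuous_exp.tendsto _).comp (hεlim.mul_const (‖ξ‖ ^ 2)).neg
      simpa [Function.comp_def] using this
    simpa using h1.const_mul (Real.exp (-(T * ψ d ν ξ)))

theorem exp_neg_quarter_sub_exp_neg_ge {v : ℝ} (h1 : 1 / 4 ≤ v) (h2 : v ≤ 1) :
    Real.exp (-1) / 8 ≤ Real.exp (-(v / 4)) - Real.exp (-v) := by
  have h3 : Real.exp (-(v / 4)) = Real.exp (-v) * Real.exp (3 / 4 * v) := by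
    rw [← Real.exp_add]; ring_nf
  have h4 := Real.add_one_le_exp (3 / 4 * v)
  have h5 : Real.exp (-1) ≤ Real.exp (-v) := Real.exp_le_exp.2 (by linarith)
  have h6 := Real.exp_pos (-1)
  rw [h3]
  nlinarith

theorem mul_volume_ball_le_integral (hd : 1 ≤ d) {P : EuclideanSpace ℝ (Fin d) → ℝ}
    (hP : IsUnimodal P) (x : EuclideanSpace ℝ (Fin d)) (hx : x ≠ 0)
    (hi : Integrable fun y => P y *
      (Real.exp (-(1 / ‖x‖ ^ 2 / 4 * ‖y‖ ^ 2)) - Real.exp (-(1 / ‖x‖ ^ 2 * ‖y‖ ^ 2)))) :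
    P x * (Real.exp (-1) / 8) * ((‖x‖ / 4) ^ d *
        (volume (Metric.ball (0 : EuclideanSpace ℝ (Fin d)) 1)).toReal)
      ≤ ∫ y, P y *
        (Real.exp (-(1 / ‖x‖ ^ 2 / 4 * ‖y‖ ^ 2)) - Real.exp (-(1 / ‖x‖ ^ 2 * ‖y‖ ^ 2))) := by
  have : Nonempty (Fin d) := ⟨⟨0, hd⟩⟩
  have hx0 := norm_pos_iff.2 hx
  set B := Metric.ball ((3 / 4 : ℝ) • x) (‖x‖ / 4) with hB
  have hvol : volume.real B = (‖x‖ / 4) ^ d *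
      (volume (Metric.ball (0 : EuclideanSpace ℝ (Fin d)) 1)).toReal := by
    rw [measureReal_def, hB, Measure.addHaar_ball _ _ (by positivity), ENNReal.toReal_mul,
      ENNReal.toReal_ofReal (by positivity), finrank_euclideanSpace_fin]
  have hnn : ∀ y : EuclideanSpace ℝ (Fin d), 0 ≤ P y *
      (Real.exp (-(1 / ‖x‖ ^ 2 / 4 * ‖y‖ ^ 2)) - Real.exp (-(1 / ‖x‖ ^ 2 * ‖y‖ ^ 2))) := by
    refine fun y => mul_nonneg (hP.1 y) (sub_nonneg.2 (Real.exp_le_exp.2 ?_))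
    have : 0 ≤ 1 / ‖x‖ ^ 2 * ‖y‖ ^ 2 := by positivity
    linarith
  calc _ = ∫ y in B, P x * (Real.exp (-1) / 8) := by
        rw [setIntegral_const, hvol, smul_eq_mul]; ring
    _ ≤ ∫ y in B, P y * (Real.exp (-(1 / ‖x‖ ^ 2 / 4 * ‖y‖ ^ 2))
          - Real.exp (-(1 / ‖x‖ ^ 2 * ‖y‖ ^ 2))) := by
        refine setIntegral_mono_on (integrableOn_const measure_ball_lt_top.ne) hi.integrableOn
          Metric.isOpen_ball.measurableSet fun y hy => ?_
        rw [hB, mem_ball_iff_norm] at hy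
        have hn : ‖(3 / 4 : ℝ) • x‖ = 3 / 4 * ‖x‖ := by
          rw [norm_smul, Real.norm_of_nonneg (by norm_num)]
        have h1 : ‖y‖ ≤ ‖x‖ := by
          have := norm_le_norm_add_norm_sub' y ((3 / 4 : ℝ) • x)
          linarith
        have h2 : ‖x‖ / 2 ≤ ‖y‖ := by
          have := norm_le_norm_add_norm_sub y ((3 / 4 : ℝ) • x)
          linarith
        have h3 := exp_neg_quarter_sub_exp_neg_ge (v := 1 / ‖x‖ ^ 2 * ‖y‖ ^ 2)
          (by
            rw [one_div_mul_eq_div, le_div_iff₀ (by positivity)]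
            nlinarith)
          (by
            rw [one_div_mul_eq_div, div_le_one (by positivity)]
            gcongr)
        rw [show 1 / ‖x‖ ^ 2 * ‖y‖ ^ 2 / 4 = 1 / ‖x‖ ^ 2 / 4 * ‖y‖ ^ 2 by ring] at h3
        have h4 := hP.2 y x h1
        have h5 := Real.exp_pos (-1)
        exact mul_le_mul h4 h3 (by positivity) (hP.1 y)
    _ ≤ _ := setIntegral_le_integral hi (Eventually.of_forall hnn)

/-- The pointwise heat kernel bound by the averaged exponent. -/
theorem exists_cosTransform_exp_neg_psi_le (hd : 1 ≤ d)
    (hν_pos : ∀ r : ℝ, 0 < r → 0 < ν r)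
    (hν_mono : ∀ r₁ r₂ : ℝ, 0 < r₁ → r₁ ≤ r₂ → ν r₂ ≤ ν r₁)
    (hint : Integrable (fun z : EuclideanSpace ℝ (Fin d) => min (‖z‖ ^ 2) 1 * ν ‖z‖)) :
    ∃ C : ℝ, 0 < C ∧ ∀ T : ℝ, 0 ≤ T →
      Integrable (fun ξ : EuclideanSpace ℝ (Fin d) => Real.exp (-(T * ψ d ν ξ))) →
      ∀ x : EuclideanSpace ℝ (Fin d), x ≠ 0 →
        cosTransform (fun ξ => Real.exp (-(T * ψ d ν ξ))) x
          ≤ C * T * gaussExponent d ν (1 / ‖x‖ ^ 2) / ‖x‖ ^ d := by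
  set V := (volume (Metric.ball (0 : EuclideanSpace ℝ (Fin d)) 1)).toReal with hV
  have hV0 : 0 < V := ENNReal.toReal_pos (Metric.measure_ball_pos _ _ one_pos).ne'
    measure_ball_lt_top.ne
  set N : ℝ := (4 * π ^ 2) ^ ((d : ℝ) / 2) with hN
  have hN0 : 0 < N := by positivity
  refine ⟨N / (Real.exp (-1) / 8 * ((1 / 4) ^ d * V)), by positivity, fun T hT hTi x hx => ?_⟩
  have hx0 := norm_pos_iff.2 hx
  set a : ℝ := 1 / ‖x‖ ^ 2 with ha
  have ha0 : 0 < a := by positivity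
  set φ : EuclideanSpace ℝ (Fin d) → ℝ := fun ξ => Real.exp (-(T * ψ d ν ξ)) with hφ
  set G : ℝ → EuclideanSpace ℝ (Fin d) → ℝ := fun c ξ =>
    (π / c) ^ ((d : ℝ) / 2) * Real.exp (-(1 / (4 * c) * ‖ξ‖ ^ 2)) with hG
  have hGi : ∀ c, 0 < c → Integrable (G c) := fun c hc =>
    (integrable_exp_neg_mul_sq_norm (by positivity)).const_mul _
  have hGN : ∀ c, 0 < c → (π / c) ^ ((d : ℝ) / 2) * (π / (1 / (4 * c))) ^ ((d : ℝ) / 2) = N := by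
    intro c hc
    rw [← Real.mul_rpow (by positivity) (by positivity), hN]
    congr 1; field_simp
  have hGint : ∀ c, 0 < c → ∫ ξ, G c ξ = N := fun c hc => by
    simp only [hG]
    rw [integral_const_mul, integral_exp_neg_mul_sq_norm d (by positivity), hGN c hc]
  have hgi : ∀ c, 0 < c → Integrable fun ξ : EuclideanSpace ℝ (Fin d) =>
      Real.exp (-(c * ‖ξ‖ ^ 2)) := fun c hc => integrable_exp_neg_mul_sq_norm hc
  set w : EuclideanSpace ℝ (Fin d) → ℝ := fun y =>
    Real.exp (-(a / 4 * ‖y‖ ^ 2)) - Real.exp (-(a * ‖y‖ ^ 2)) with hw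
  have hwi : Integrable w := (hgi _ (by positivity)).sub (hgi _ ha0)
  have hwG : ∀ ξ, cosTransform w ξ = G (a / 4) ξ - G a ξ := fun ξ => by
    have h1 := cosTransform_gaussian (show 0 < a / 4 by positivity) ξ
    have h2 := cosTransform_gaussian ha0 ξ
    rw [finrank_euclideanSpace_fin] at h1 h2
    simp only [hG]
    rw [one_div_mul_eq_div, one_div_mul_eq_div, ← h1, ← h2]
    simp only [cosTransform, hw]
    rw [← integral_sub (integrable_cos_mul (hgi _ (by positivity)) ξ)
      (integrable_cos_mul (hgi _ ha0) ξ)]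
    congr 1; funext y; ring
  have hPu := isUnimodal_cosTransform_exp_neg_psi hd hν_pos hν_mono hint hT hTi
  have hPwi : Integrable fun y => cosTransform φ y * w y :=
    hwi.bdd_mul (c := ∫ ξ, |φ ξ|) (continuous_cosTransform hTi).aestronglyMeasurable
      (Eventually.of_forall fun y => abs_cosTransform_le y hTi)
  have hlow := mul_volume_ball_le_integral hd hPu x hx hPwi
  obtain ⟨hψi, hψeq⟩ := integral_psi_mul_gaussian (ν := ν) hd hint
    (show 0 < 1 / (4 * a) by positivity)
  rw [show 1 / (4 * (1 / (4 * a))) = a by field_simp] at hψeq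
  have hφ1 : ∀ ξ, 0 ≤ φ ξ ∧ φ ξ ≤ 1 := fun ξ =>
    ⟨(Real.exp_pos _).le, Real.exp_le_one_iff.2
      (neg_nonpos.2 (mul_nonneg hT (psi_nonneg hd hν_pos ξ)))⟩
  have hφG : ∀ c, 0 < c → Integrable fun ξ => φ ξ * G c ξ := fun c hc =>
    (hGi c hc).bdd_mul (c := 1) hTi.1 (Eventually.of_forall fun ξ => by
      rw [Real.norm_of_nonneg (hφ1 ξ).1]; exact (hφ1 ξ).2)
  have hG0 : ∀ c, 0 < c → ∀ ξ, 0 ≤ G c ξ := fun c hc ξ => by positivity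
  have hup : ∫ y, cosTransform φ y * w y ≤ N * T * gaussExponent d ν a := by
    rw [integral_cosTransform_mul hTi hwi]
    simp only [hwG, mul_sub]
    rw [integral_sub (hφG _ (by positivity)) (hφG _ ha0)]
    have h1 : ∫ ξ, φ ξ * G (a / 4) ξ ≤ N := by
      rw [← hGint (a / 4) (by positivity)]
      exact integral_mono (hφG _ (by positivity)) (hGi _ (by positivity)) fun ξ =>
        mul_le_of_le_one_left (hG0 _ (by positivity) ξ) (hφ1 ξ).2
    have h2 : N - ∫ ξ, φ ξ * G a ξ = ∫ ξ, (G a ξ - φ ξ * G a ξ) := by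
      rw [integral_sub (hGi a ha0) (hφG a ha0), hGint a ha0]
    have h3 : ∫ ξ, (G a ξ - φ ξ * G a ξ) ≤ ∫ ξ, (T * (π / a) ^ ((d : ℝ) / 2)) *
        (ψ d ν ξ * Real.exp (-(1 / (4 * a) * ‖ξ‖ ^ 2))) := by
      refine integral_mono ((hGi a ha0).sub (hφG a ha0)) (hψi.const_mul _) fun ξ => ?_
      have h4 := Real.add_one_le_exp (-(T * ψ d ν ξ))
      have h5 : 1 - φ ξ ≤ T * ψ d ν ξ := by simp only [hφ]; linarith
      have h6 := mul_le_mul_of_nonneg_right h5 (hG0 a ha0 ξ)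
      simp only [hG] at h6 ⊢
      linarith
    rw [integral_const_mul, hψeq] at h3
    have h7 := hGN a ha0
    have h8 : T * (π / a) ^ ((d : ℝ) / 2) *
        ((π / (1 / (4 * a))) ^ ((d : ℝ) / 2) * gaussExponent d ν a)
        = N * T * gaussExponent d ν a := by rw [← h7]; ring
    linarith
  have hfin := hlow.trans hup
  rw [div_pow, ← hV] at hfin
  rw [le_div_iff₀ (by positivity)]
  have hc : 0 < Real.exp (-1) / 8 * ((1 / 4) ^ d * V) := by positivity
  rw [show N / (Real.exp (-1) / 8 * ((1 / 4) ^ d * V)) * T * gaussExponent d ν a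
    = N * T * gaussExponent d ν a / (Real.exp (-1) / 8 * ((1 / 4) ^ d * V)) by ring,
    le_div_iff₀ hc]
  refine le_trans (le_of_eq ?_) hfin
  rw [one_div_pow]
  ring

end HeatKernel

section Scaling

variable {d : ℕ} {ν : ℝ → ℝ}

theorem exists_gaussExponent_quarter_le (hd : 1 ≤ d)
    (hν_pos : ∀ r : ℝ, 0 < r → 0 < ν r)
    (hν_mono : ∀ r₁ r₂ : ℝ, 0 < r₁ → r₁ ≤ r₂ → ν r₂ ≤ ν r₁)
    (hint : Integrable (fun z : EuclideanSpace ℝ (Fin d) => min (‖z‖ ^ 2) 1 * ν ‖z‖))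
    {α γ : ℝ} (hγ : γ < α)
    (hA2 : Tendsto (fun r : ℝ => ν (2 * r) / ν r) atTop (nhds (2 ^ (-(d:ℝ) - α)))) :
    ∃ C : ℝ, 0 ≤ C ∧ ∀ a : ℝ, 0 < a →
      gaussExponent d ν (a / 4) ≤ 2 ^ (-γ) * gaussExponent d ν a + C * a := by
  have hlt : (2 : ℝ) ^ (-(d:ℝ) - α) < 2 ^ (-(d:ℝ) - γ) :=
    Real.rpow_lt_rpow_of_exponent_lt one_lt_two (by linarith)
  obtain ⟨R, hR⟩ := eventually_atTop.1 (hA2.eventually_lt_const hlt)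
  set m : EuclideanSpace ℝ (Fin d) → ℝ := fun z => min (‖z‖ ^ 2) 1 * ν ‖z‖ with hm
  have hm0 : 0 ≤ ∫ z, m z := by
    refine integral_nonneg_of_ae ?_
    filter_upwards [ae_ne_zero hd] with z hz
    exact mul_nonneg (min_sq_one_nonneg z) (hν_pos _ (norm_pos_iff.2 hz)).le
  refine ⟨2 ^ d * ((1 + R ^ 2) * ∫ z, m z), by positivity, fun a ha => ?_⟩
  have hscale := Measure.integral_comp_smul (volume : Measure (EuclideanSpace ℝ (Fin d)))
    (fun z => (1 - Real.exp (-(a / 4 * ‖z‖ ^ 2))) * ν ‖z‖) 2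
  rw [finrank_euclideanSpace_fin, abs_of_pos (by positivity), smul_eq_mul,
    ← gaussExponent] at hscale
  have h2 : gaussExponent d ν (a / 4) = 2 ^ d *
      ∫ z : EuclideanSpace ℝ (Fin d), (1 - Real.exp (-(a * ‖z‖ ^ 2))) * ν (2 * ‖z‖) := by
    have hnorm : ∀ z : EuclideanSpace ℝ (Fin d), ‖(2 : ℝ) • z‖ = 2 * ‖z‖ := fun z => by
      rw [norm_smul, Real.norm_of_nonneg zero_le_two]
    have hsq : ∀ v : ℝ, a / 4 * (2 * v) ^ 2 = a * v ^ 2 := fun v => by ring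
    simp only [hnorm, hsq] at hscale
    rw [hscale, mul_inv_cancel_left₀ (by positivity)]
  have hbi : Integrable fun z : EuclideanSpace ℝ (Fin d) =>
      2 ^ (-(d:ℝ) - γ) * ((1 - Real.exp (-(a * ‖z‖ ^ 2))) * ν ‖z‖)
        + a * (1 + R ^ 2) * m z :=
    ((integrable_gaussExponent hd hint ha.le).const_mul _).add (hint.const_mul _)
  have hle : ∫ z : EuclideanSpace ℝ (Fin d), (1 - Real.exp (-(a * ‖z‖ ^ 2))) * ν (2 * ‖z‖)
      ≤ 2 ^ (-(d:ℝ) - γ) * gaussExponent d ν a + a * (1 + R ^ 2) * ∫ z, m z := by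
    unfold gaussExponent
    rw [← integral_const_mul, ← integral_const_mul,
      ← integral_add ((integrable_gaussExponent hd hint ha.le).const_mul _) (hint.const_mul _)]
    refine integral_mono_of_nonneg ?_ hbi ?_
    · filter_upwards [ae_ne_zero hd] with z hz
      have := norm_pos_iff.2 hz
      exact mul_nonneg (one_sub_exp_neg_nonneg (by positivity)) (hν_pos _ (by positivity)).le
    · filter_upwards [ae_ne_zero hd] with z hz
      have hz' := norm_pos_iff.2 hz
      have hν := hν_pos _ hz'
      have he : 0 ≤ 1 - Real.exp (-(a * ‖z‖ ^ 2)) := one_sub_exp_neg_nonneg (by positivity)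
      rcases le_or_gt R ‖z‖ with hRz | hRz
      · have h3 : ν (2 * ‖z‖) ≤ 2 ^ (-(d:ℝ) - γ) * ν ‖z‖ := ((div_lt_iff₀ hν).1 (hR _ hRz)).le
        have h4 : 0 ≤ a * (1 + R ^ 2) * m z :=
          mul_nonneg (by positivity) (mul_nonneg (min_sq_one_nonneg z) hν.le)
        have h5 := mul_le_mul_of_nonneg_left h3 he
        linarith
      · have h3 : ν (2 * ‖z‖) ≤ ν ‖z‖ := hν_mono _ _ hz' (by linarith)
        have h4 : 1 - Real.exp (-(a * ‖z‖ ^ 2)) ≤ a * ‖z‖ ^ 2 := by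
          linarith [Real.add_one_le_exp (-(a * ‖z‖ ^ 2))]
        have h5 : ‖z‖ ^ 2 ≤ (1 + R ^ 2) * min (‖z‖ ^ 2) 1 := by
          have h6 : ‖z‖ ^ 2 ≤ R ^ 2 := by gcongr
          rcases min_cases (‖z‖ ^ 2) 1 with ⟨h, _⟩ | ⟨h, _⟩ <;> rw [h] <;>
            nlinarith [mul_nonneg (sq_nonneg R) (sq_nonneg ‖z‖)]
        have h6 : 0 ≤ 2 ^ (-(d:ℝ) - γ) * ((1 - Real.exp (-(a * ‖z‖ ^ 2))) * ν ‖z‖) :=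
          mul_nonneg (by positivity) (mul_nonneg he hν.le)
        have h7 : (1 - Real.exp (-(a * ‖z‖ ^ 2))) * ν (2 * ‖z‖)
            ≤ a * ((1 + R ^ 2) * min (‖z‖ ^ 2) 1) * ν ‖z‖ :=
          mul_le_mul (h4.trans (mul_le_mul_of_nonneg_left h5 ha.le)) h3
            (hν_pos _ (by positivity)).le
            (mul_nonneg ha.le (mul_nonneg (by positivity) (min_sq_one_nonneg z)))
        simp only [hm]
        linarith
  have hpow : (2 : ℝ) ^ d * 2 ^ (-(d:ℝ) - γ) = 2 ^ (-γ) := by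
    rw [← Real.rpow_natCast, ← Real.rpow_add two_pos]; ring_nf
  rw [h2, ← hpow]
  have := mul_le_mul_of_nonneg_left hle (show (0 : ℝ) ≤ 2 ^ d by positivity)
  linarith

/-- A Potter-type bound for `gaussExponent` near zero. -/
theorem exists_gaussExponent_div_sq_le (hd : 1 ≤ d)
    (hν_pos : ∀ r : ℝ, 0 < r → 0 < ν r)
    (hν_mono : ∀ r₁ r₂ : ℝ, 0 < r₁ → r₁ ≤ r₂ → ν r₂ ≤ ν r₁)
    (hint : Integrable (fun z : EuclideanSpace ℝ (Fin d) => min (‖z‖ ^ 2) 1 * ν ‖z‖))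
    {α γ : ℝ} (hγ0 : 0 ≤ γ) (hγ1 : γ ≤ 1) (hγ : γ < α)
    (hA2 : Tendsto (fun r : ℝ => ν (2 * r) / ν r) atTop (nhds (2 ^ (-(d:ℝ) - α))))
    {δ : ℝ} (hδ : 0 < δ) :
    ∃ C : ℝ, 0 < C ∧ ∀ a : ℝ, 0 < a → a ≤ 1 → ∀ l : ℝ, δ ≤ l →
      gaussExponent d ν (a / l ^ 2) ≤ C * l ^ (-γ) * gaussExponent d ν a := by
  obtain ⟨C, hC, hq⟩ := exists_gaussExponent_quarter_le hd hν_pos hν_mono hint hγ hA2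
  set Q := gaussExponent d ν with hQ
  have hQpos : ∀ {a : ℝ}, 0 < a → 0 < Q a := fun ha => gaussExponent_pos hd hν_pos hint ha
  have hQ1 := hQpos one_pos
  have hhalf : (1 / 2 : ℝ) ≤ 2 ^ (-γ) := by
    rw [one_div, ← Real.rpow_neg_one]
    exact Real.rpow_le_rpow_of_exponent_le one_le_two (by linarith)
  have hiter : ∀ (k : ℕ) (a : ℝ), 0 < a →
      Q (a / 4 ^ k) + 4 * C * (a / 4 ^ k) ≤ (2 ^ (-γ)) ^ k * (Q a + 4 * C * a) := by
    intro k a ha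
    induction k with
    | zero => simp
    | succ k ih =>
      have hak : 0 < a / 4 ^ k := by positivity
      have h1 := hq (a / 4 ^ k) hak
      rw [div_div, ← pow_succ] at h1
      have h2 : a / 4 ^ (k + 1) = a / 4 ^ k / 4 := by rw [pow_succ, div_div]
      have h3 := mul_le_mul_of_nonneg_left ih (show (0 : ℝ) ≤ 2 ^ (-γ) by positivity)
      have h4 : 2 * (C * (a / 4 ^ k)) ≤ 2 ^ (-γ) * (4 * C * (a / 4 ^ k)) := by
        have := mul_nonneg hC hak.le
        nlinarith
      have h5 : 4 * C * (a / 4 ^ (k + 1)) = C * (a / 4 ^ k) := by rw [h2]; ring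
      rw [pow_succ (2 ^ (-γ) : ℝ), h5]
      linarith
  set A := 1 + 4 * C / Q 1 with hA
  have hA0 : 0 < A := by positivity
  refine ⟨2 * A + 1 / δ ^ 2, by positivity, fun a ha ha1 l hl => ?_⟩
  have hl0 : 0 < l := hδ.trans_le hl
  have hlγ : 0 < l ^ (-γ) := Real.rpow_pos_of_pos hl0 _
  have hQa := hQpos ha
  rcases le_or_gt 1 l with h1 | h1
  · obtain ⟨n, hn1, hn2⟩ := exists_nat_pow_near h1 one_lt_two
    have h2 : Q (a / l ^ 2) ≤ Q (a / 4 ^ n) := by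
      refine gaussExponent_mono hd hν_pos hint (by positivity) ?_
      have : (4 : ℝ) ^ n ≤ l ^ 2 := by
        rw [show (4 : ℝ) = 2 ^ 2 by norm_num, ← pow_mul, mul_comm, pow_mul]
        gcongr
      gcongr
    have h3 : a * Q 1 ≤ Q a := by
      have := gaussExponent_mul_le hd hν_pos hint ha.le ((one_le_div ha).2 ha1)
      rw [one_div_mul_cancel ha.ne', one_div_mul_eq_div, le_div_iff₀ ha] at this
      linarith
    have h4 : Q a + 4 * C * a ≤ A * Q a := by
      have : a ≤ Q a / Q 1 := (le_div_iff₀ hQ1).2 h3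
      have h5 := mul_le_mul_of_nonneg_left this (show 0 ≤ 4 * C by positivity)
      rw [hA, add_mul, one_mul, div_mul_eq_mul_div]
      rw [← mul_div_assoc] at h5
      linarith
    have h5 : ((2 : ℝ) ^ (-γ)) ^ n ≤ 2 * l ^ (-γ) := by
      have h6 : ((2 : ℝ) ^ (n + 1)) ^ (-γ) ≤ l ^ (-γ) :=
        Real.rpow_le_rpow_of_nonpos hl0 hn2.le (by linarith)
      rw [← Real.rpow_natCast, ← Real.rpow_mul zero_le_two, mul_comm, Real.rpow_mul zero_le_two,
        Real.rpow_natCast, pow_succ] at h6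
      have h7 : 0 < ((2 : ℝ) ^ (-γ)) ^ n := by positivity
      nlinarith
    have h6 := hiter n a ha
    have h7 : 0 ≤ 4 * C * (a / 4 ^ n) := by positivity
    calc Q (a / l ^ 2) ≤ (2 ^ (-γ)) ^ n * (Q a + 4 * C * a) := by linarith
      _ ≤ (2 * l ^ (-γ)) * (A * Q a) := by gcongr
      _ ≤ (2 * l ^ (-γ)) * (A * Q a) + 1 / δ ^ 2 * l ^ (-γ) * Q a :=
        le_add_of_nonneg_right (by positivity)
      _ = _ := by ring
  · have h2 : (1 : ℝ) ≤ 1 / l ^ 2 := (one_le_div (by positivity)).2 (pow_le_one₀ hl0.le h1.le)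
    have h3 := gaussExponent_mul_le hd hν_pos hint ha.le h2
    rw [one_div_mul_eq_div] at h3
    have h4 : 1 / l ^ 2 ≤ 1 / δ ^ 2 := by gcongr
    have h5 : 1 ≤ l ^ (-γ) :=
      Real.one_le_rpow_of_pos_of_le_one_of_nonpos hl0 h1.le (by linarith)
    calc Q (a / l ^ 2) ≤ 1 / l ^ 2 * Q a := h3
      _ ≤ 1 / δ ^ 2 * Q a * 1 := by rw [mul_one]; gcongr
      _ ≤ 1 / δ ^ 2 * Q a * l ^ (-γ) := by gcongr
      _ ≤ 1 / δ ^ 2 * Q a * l ^ (-γ) + 2 * A * l ^ (-γ) * Q a :=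
        le_add_of_nonneg_right (by positivity)
      _ = _ := by ring

theorem psi_le_of_norm_lt_psiinv (hd : 1 ≤ d)
    (hint : Integrable (fun z : EuclideanSpace ℝ (Fin d) => min (‖z‖ ^ 2) 1 * ν ‖z‖))
    {σ : ℝ} {ξ : EuclideanSpace ℝ (Fin d)} (hξ : ‖ξ‖ < ψinv d ν σ) : ψ d ν ξ ≤ σ := by
  unfold ψinv at hξ
  rcases Set.eq_empty_or_nonempty {r : ℝ | 0 ≤ r ∧ ψstar d ν r = σ} with h | h
  · rw [h, Real.sSup_empty] at hξ
    exact absurd hξ (norm_nonneg ξ).not_gt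
  · obtain ⟨r, ⟨hr0, hr⟩, hlt⟩ := exists_lt_of_lt_csSup h hξ
    rw [← hr]
    refine le_csSup ⟨2 * (1 + r ^ 2) *
      ∫ z : EuclideanSpace ℝ (Fin d), |min (‖z‖ ^ 2) 1 * ν ‖z‖|, ?_⟩ ⟨ξ, hlt.le, rfl⟩
    rintro y ⟨z, hz, rfl⟩
    refine (psi_le hd hint z).trans ?_
    have : 0 ≤ ∫ z : EuclideanSpace ℝ (Fin d), |min (‖z‖ ^ 2) 1 * ν ‖z‖| :=
      integral_nonneg fun z => abs_nonneg _
    gcongr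

theorem psiinv_nonneg (d : ℕ) (ν : ℝ → ℝ) (σ : ℝ) : 0 ≤ ψinv d ν σ :=
  Real.sSup_nonneg fun _ hr => hr.1

theorem not_integrable_cos_inner (hd : 1 ≤ d) (u : EuclideanSpace ℝ (Fin d)) :
    ¬ Integrable (fun ξ : EuclideanSpace ℝ (Fin d) => Real.cos ⟪ξ, u⟫) := by
  intro h
  have : Nonempty (Fin d) := ⟨⟨0, hd⟩⟩
  have h1 : Integrable (fun ξ : EuclideanSpace ℝ (Fin d) => Real.cos ⟪(2 : ℝ) • ξ, u⟫) :=
    h.comp_smul (two_ne_zero)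
  have h2 := (integrable_cos_mul h u).const_mul 2
  have h3 : Integrable (fun _ : EuclideanSpace ℝ (Fin d) => (1 : ℝ)) := by
    refine (h2.sub h1).congr (Eventually.of_forall fun ξ => ?_)
    simp only [Pi.sub_apply, inner_smul_left, RCLike.conj_to_real]
    rw [Real.cos_two_mul]; ring
  rcases integrable_const_iff.1 h3 with h4 | h4
  · exact one_ne_zero h4
  · have h5 := measure_univ_of_isAddLeftInvariant
      (volume : Measure (EuclideanSpace ℝ (Fin d)))
    have := (isFiniteMeasure_iff _).1 h4
    rw [h5] at this
    exact lt_irrefl _ this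

theorem pts_eq_zero (hd : 1 ≤ d) {s t : ℝ} (hb : ψinv d ν (1 / s) = 0)
    (u : EuclideanSpace ℝ (Fin d)) : pts d ν s t u = 0 := by
  have hψ : ψ d ν 0 = 0 := by simp [ψ]
  have h : ∀ ξ, ψs d ν s ξ = 0 := fun ξ => by rw [ψs, hb, zero_smul, hψ, mul_zero]
  simp only [pts, h, mul_zero, neg_zero, Real.exp_zero, mul_one]
  rw [integral_undef (not_integrable_cos_inner hd u), mul_zero]

theorem pts_eq_cosTransform {s t : ℝ} (hb : 0 < ψinv d ν (1 / s))
    (u : EuclideanSpace ℝ (Fin d)) :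
    pts d ν s t u = ((2 * π) ^ d)⁻¹ * ((ψinv d ν (1 / s) ^ d)⁻¹ *
      cosTransform (fun ξ => Real.exp (-(s * t * ψ d ν ξ))) ((ψinv d ν (1 / s))⁻¹ • u)) := by
  set b := ψinv d ν (1 / s) with hbdef
  have h := Measure.integral_comp_smul (volume : Measure (EuclideanSpace ℝ (Fin d)))
    (fun η => Real.cos ⟪η, b⁻¹ • u⟫ * Real.exp (-(s * t * ψ d ν η))) b
  rw [finrank_euclideanSpace_fin, abs_of_pos (by positivity), smul_eq_mul] at h
  rw [cosTransform, ← h, pts]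
  congr 2; funext ξ
  rw [inner_smul_left, inner_smul_right, RCLike.conj_to_real, mul_inv_cancel_left₀ hb.ne', ψs,
    ← hbdef]
  congr 3; ring

end Scaling

end LevyHeatKernel

theorem statement15
    (d : ℕ) (hd : 1 ≤ d) (ν : ℝ → ℝ)
    (hν_pos : ∀ r : ℝ, 0 < r → 0 < ν r)
    (hν_mono : ∀ r₁ r₂ : ℝ, 0 < r₁ → r₁ ≤ r₂ → ν r₂ ≤ ν r₁)
    (hint : Integrable (fun z : EuclideanSpace ℝ (Fin d) => min (‖z‖ ^ 2) 1 * ν ‖z‖))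
    (hninf : ¬ Integrable (fun z : EuclideanSpace ℝ (Fin d) => ν ‖z‖))
    (β M : ℝ) (hβ : β ∈ Set.Ioo (0:ℝ) 2) (hM : 1 < M)
    (hA1 : ∀ r₁ r₂ : ℝ, 0 < r₁ → r₁ < r₂ → ν r₁ ≤ M * (r₂ / r₁) ^ ((d:ℝ) + β) * ν r₂)
    (α : ℝ) (hα : α ∈ Set.Ioo (0:ℝ) 2)
    (hA2 : ∀ lam : ℝ, 0 < lam →
      Tendsto (fun r : ℝ => ν (lam * r) / ν r) atTop (nhds (lam ^ (-(d:ℝ) - α))))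
    (t₀ : ℝ) (ht₀ : 0 < t₀)
    (hA3 : Integrable (fun ξ : EuclideanSpace ℝ (Fin d) => Real.exp (-(t₀ * ψ d ν ξ))))
    (hnorm : ∀ ξ : EuclideanSpace ℝ (Fin d), ‖ξ‖ = 1 → ψ d ν ξ = 1)
:
    ∀ δ : ℝ, 0 < δ → ∃ s₀ C : ℝ, 1 ≤ s₀ ∧ 0 < C ∧
      ∀ s t : ℝ, s₀ ≤ s → 0 < t → t₀ ≤ s * t →
        ∀ u : EuclideanSpace ℝ (Fin d), δ ≤ ‖u‖ →
          pts d ν s t u ≤ C * t * ‖u‖ ^ (-(d:ℝ) - α / 2) := by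
  intro δ hδ
  obtain ⟨hα0, hα2⟩ := hα
  obtain ⟨C₁, hC₁, hker⟩ :=
    LevyHeatKernel.exists_cosTransform_exp_neg_psi_le hd hν_pos hν_mono hint
  obtain ⟨C₂, hC₂, hdecay⟩ := LevyHeatKernel.exists_gaussExponent_div_sq_le hd hν_pos hν_mono hint
    (γ := α / 2) (by linarith) (by linarith) (by linarith) (hA2 2 two_pos) hδ
  have hQ1 := LevyHeatKernel.gaussExponent_pos hd hν_pos hint one_pos
  set Q := LevyHeatKernel.gaussExponent d ν with hQ
  set κ : ℝ := 36 * 2 ^ ((d : ℝ) / 2) with hκ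
  have hκ0 : 0 < κ := by positivity
  refine ⟨max 1 (κ / Q 1 + 1), ((2 * π) ^ d)⁻¹ * C₁ * C₂ * κ, le_max_left _ _, by positivity,
    fun s t hs ht hst u hu => ?_⟩
  have hs1 : 1 ≤ s := (le_max_left _ _).trans hs
  have hs0 : 0 < s := by linarith
  have hu0 : 0 < ‖u‖ := hδ.trans_le hu
  have hu_ne : u ≠ 0 := norm_pos_iff.1 hu0
  rcases (LevyHeatKernel.psiinv_nonneg d ν (1 / s)).eq_or_lt with hb | hb
  · rw [LevyHeatKernel.pts_eq_zero hd hb.symm u]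
    positivity
  have hpts := LevyHeatKernel.pts_eq_cosTransform (t := t) hb u
  set b := ψinv d ν (1 / s) with hbdef
  have hQb : Q (b ^ 2) ≤ κ * (1 / s) :=
    LevyHeatKernel.gaussExponent_le_of_psi_le_on_ball hd hν_pos hint hb (by positivity)
      fun ξ hξ => LevyHeatKernel.psi_le_of_norm_lt_psiinv hd hint hξ
  have hb1 : b ^ 2 ≤ 1 := by
    by_contra! hlt
    have h1 : Q 1 ≤ κ * (1 / s) :=
      (LevyHeatKernel.gaussExponent_mono hd hν_pos hint zero_le_one hlt.le).trans hQb
    have h2 : κ / Q 1 < s := by linarith [(le_max_right 1 (κ / Q 1 + 1)).trans hs]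
    rw [div_lt_iff₀ hQ1] at h2
    rw [mul_one_div, le_div_iff₀ hs0] at h1
    linarith
  have hTi : Integrable (fun ξ : EuclideanSpace ℝ (Fin d) => Real.exp (-(s * t * ψ d ν ξ))) := by
    have hm := LevyHeatKernel.aestronglyMeasurable_psi hd hint
    refine hA3.mono' (Real.continuous_exp.comp_aestronglyMeasurable (hm.const_mul _).neg)
      (Eventually.of_forall fun ξ => ?_)
    rw [Real.norm_of_nonneg (Real.exp_pos _).le]
    have := LevyHeatKernel.psi_nonneg hd hν_pos ξ
    gcongr
  have hP := hker (s * t) (by positivity) hTi (b⁻¹ • u) (smul_ne_zero (by positivity) hu_ne)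
  have hn : ‖b⁻¹ • u‖ = ‖u‖ / b := by
    rw [norm_smul, Real.norm_of_nonneg (by positivity), inv_mul_eq_div]
  rw [hn, show 1 / (‖u‖ / b) ^ 2 = b ^ 2 / ‖u‖ ^ 2 by field_simp] at hP
  have hD := hdecay (b ^ 2) (by positivity) hb1 ‖u‖ hu
  have hD2 : Q (b ^ 2 / ‖u‖ ^ 2) ≤ C₂ * ‖u‖ ^ (-(α / 2)) * (κ * (1 / s)) :=
    hD.trans (mul_le_mul_of_nonneg_left hQb (by positivity))
  have hpow : ‖u‖ ^ (-(d:ℝ) - α / 2) = ‖u‖ ^ (-(α / 2)) / ‖u‖ ^ d := by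
    rw [← Real.rpow_natCast, ← Real.rpow_sub hu0]; ring_nf
  rw [hpts, hpow]
  calc ((2 * π) ^ d)⁻¹ * ((b ^ d)⁻¹ * _)
      ≤ ((2 * π) ^ d)⁻¹ * ((b ^ d)⁻¹ * (C₁ * (s * t) *
          (C₂ * ‖u‖ ^ (-(α / 2)) * (κ * (1 / s))) / (‖u‖ / b) ^ d)) := by
        refine mul_le_mul_of_nonneg_left (mul_le_mul_of_nonneg_left (hP.trans ?_) ?_) ?_
        · gcongr
        · positivity
        · positivity
    _ = ((2 * π) ^ d)⁻¹ * C₁ * C₂ * κ * t * (‖u‖ ^ (-(α / 2)) / ‖u‖ ^ d) := by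
        rw [div_pow]
        field_simp

end
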